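/- arXiv:0707.1113 — 7 statements merged into one kernel-verified Lean document; each statement's English description precedes it below -/
import Mathlib

section
/- Let J₁, J₂ be nonsingular J-tensors for the metric g on U with σ₁ = det J₁, let V, W : U → ℝ be smooth with the bi-cofactor condition (cof J₁)⁻¹∇V = (cof J₂)⁻¹∇W, define K₁, …, Kₙ by cof(J₂ + ξJ₁) = Σ_{i=0}^{n−1} K_{n−i} ξ^i, V₁ = V, and let V₂, …, Vₙ be smooth with ∇V_r = (1/σ₁) K_r J₁ ∇V₁, and set H_r(q,p) = (1/2)pᵀ K_r G p + V_r(q). Then the functions H₁, …, Hₙ are in involution with respect to both brackets: {H_r, H_s}_{Π_nc(J₁)} = 0 and {H_r, H_s}_{Π_nc(J₂)} = 0 for all r, s = 1, …, n, where {f,h}_Π = (df)ᵀ Π dh. -/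
noncomputable section
open Matrix

/-- Partial derivative `∂f/∂q^i` of a scalar function on `ℝⁿ`. -/
def pd {n : ℕ} (f : (Fin n → ℝ) → ℝ) (i : Fin n) (q : Fin n → ℝ) : ℝ :=
  fderiv ℝ f q (Pi.single i 1)

/-- Christoffel symbols `Γ^i_{jk}` of a metric `g` (with `G = g⁻¹`). -/
def christoffel {n : ℕ} (g : (Fin n → ℝ) → Matrix (Fin n) (Fin n) ℝ)
    (i j k : Fin n) (q : Fin n → ℝ) : ℝ :=
  (1 / 2) * ∑ l, (g q)⁻¹ i l *
    (pd (fun q' => g q' l k) j q + pd (fun q' => g q' l j) k q - pd (fun q' => g q' j k) l q)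

/-- Gradient with respect to the metric `g`: `(∇V)^i = G^{ij} ∂_j V`. -/
def grad {n : ℕ} (g : (Fin n → ℝ) → Matrix (Fin n) (Fin n) ℝ)
    (V : (Fin n → ℝ) → ℝ) (q : Fin n → ℝ) : Fin n → ℝ :=
  (g q)⁻¹ *ᵥ (fun j => pd V j q)

/-- Covariant derivative `∇_h J^i_j` of a (1,1)-tensor field. -/
def covDeriv {n : ℕ} (g J : (Fin n → ℝ) → Matrix (Fin n) (Fin n) ℝ)
    (h i j : Fin n) (q : Fin n → ℝ) : ℝ :=
  pd (fun q' => J q' i j) h q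
    + ∑ l, christoffel g i h l q * J q l j
    - ∑ l, christoffel g l h j q * J q i l

/-- `J` is a J-tensor for the metric `g` on `U`: `JG` is symmetric and
`∇_h J^i_j = α_j δ^i_h + α^i g_{jh}` for some 1-form `α`. -/
def IsJTensor {n : ℕ} (U : Set (Fin n → ℝ))
    (g J : (Fin n → ℝ) → Matrix (Fin n) (Fin n) ℝ) : Prop :=
  (∀ i j, ContDiffOn ℝ (⊤ : ℕ∞) (fun q => J q i j) U) ∧
  (∀ q ∈ U, (J q * (g q)⁻¹).IsSymm) ∧
  ∃ α : (Fin n → ℝ) → (Fin n → ℝ), ∀ q ∈ U, ∀ h i j,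
    covDeriv g J h i j q =
      α q j * (if i = h then (1 : ℝ) else 0) + (∑ k, (g q)⁻¹ i k * α q k) * g q j h

/-- The matrix `Ω^i_j = (∂J^k_i/∂q^j − ∂J^k_j/∂q^i) p_k` appearing in the
lower-right block of the noncanonical Poisson operator `Π_nc(J)`. -/
def Omega {n : ℕ} (J : (Fin n → ℝ) → Matrix (Fin n) (Fin n) ℝ)
    (q p : Fin n → ℝ) (i j : Fin n) : ℝ :=
  ∑ k, (pd (fun q' => J q' k i) j q - pd (fun q' => J q' k j) i q) * p k

/-- The Poisson bracket `{f,h}_{Π_nc(J)} = (df)ᵀ Π_nc(J) dh` on the phase space,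
where `Π_nc(J) = [[0, J],[−Jᵀ, Ω]]`. -/
def ncBracket {n : ℕ} (J : (Fin n → ℝ) → Matrix (Fin n) (Fin n) ℝ)
    (f h : (Fin n → ℝ) → (Fin n → ℝ) → ℝ) (q p : Fin n → ℝ) : ℝ :=
  (∑ i, ∑ j, pd (fun q' => f q' p) i q * J q i j * pd (fun p' => h q p') j p)
    - (∑ i, ∑ j, pd (fun p' => f q p') i p * J q j i * pd (fun q' => h q' p) j q)
    + (∑ i, ∑ j, pd (fun p' => f q p') i p * Omega J q p i j * pd (fun p' => h q p') j p)

/-- A matrix field is entrywise differentiable at `q`. -/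
def MatDifferentiableAt {m n : ℕ} (M : (Fin m → ℝ) → Matrix (Fin n) (Fin n) ℝ)
    (q : Fin m → ℝ) : Prop :=
  ∀ i j, DifferentiableAt ℝ (fun q' => M q' i j) q

/-- Entrywise directional derivative of a matrix field. -/
def matDeriv {m n : ℕ} (M : (Fin m → ℝ) → Matrix (Fin n) (Fin n) ℝ)
    (q w : Fin m → ℝ) : Matrix (Fin n) (Fin n) ℝ :=
  Matrix.of fun i j => fderiv ℝ (fun q' => M q' i j) q w

lemma fderiv_eq_sum_pd {n : ℕ} (f : (Fin n → ℝ) → ℝ) (q w : Fin n → ℝ) :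
    fderiv ℝ f q w = ∑ i, pd f i q * w i := by
  conv_lhs => rw [pi_eq_sum_univ' w]
  simp [pd, map_sum, mul_comm]

lemma matDeriv_apply {m n : ℕ} (M : (Fin m → ℝ) → Matrix (Fin n) (Fin n) ℝ)
    (q w : Fin m → ℝ) (i j : Fin n) :
    matDeriv M q w i j = fderiv ℝ (fun q' => M q' i j) q w := rfl

lemma matDeriv_sum_smul {m n : ℕ} {ι : Type*} (s : Finset ι)
    (M : (Fin m → ℝ) → Matrix (Fin n) (Fin n) ℝ) (q : Fin m → ℝ)
    (c : ι → ℝ) (w : ι → Fin m → ℝ) :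
    matDeriv M q (∑ k ∈ s, c k • w k) = ∑ k ∈ s, c k • matDeriv M q (w k) := by
  ext i j
  simp [matDeriv_apply, map_sum, Matrix.sum_apply]

lemma MatDifferentiableAt.mul {m n : ℕ} {M N : (Fin m → ℝ) → Matrix (Fin n) (Fin n) ℝ}
    {q : Fin m → ℝ} (hM : MatDifferentiableAt M q) (hN : MatDifferentiableAt N q) :
    MatDifferentiableAt (fun q' => M q' * N q') q := by
  intro i j
  simp only [Matrix.mul_apply]
  exact DifferentiableAt.fun_sum fun k _ => (hM i k).fun_mul (hN k j)

lemma MatDifferentiableAt.add_const_smul {m n : ℕ}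
    {M N : (Fin m → ℝ) → Matrix (Fin n) (Fin n) ℝ}
    {q : Fin m → ℝ} (hM : MatDifferentiableAt M q) (hN : MatDifferentiableAt N q) (c : ℝ) :
    MatDifferentiableAt (fun q' => M q' + c • N q') q := by
  intro i j
  simp only [Matrix.add_apply, Matrix.smul_apply, smul_eq_mul]
  exact (hM i j).fun_add ((hN i j).const_mul c)

lemma matDeriv_add_const_smul {m n : ℕ}
    {M N : (Fin m → ℝ) → Matrix (Fin n) (Fin n) ℝ}
    {q : Fin m → ℝ} (hM : MatDifferentiableAt M q) (hN : MatDifferentiableAt N q) (c : ℝ)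
    (w : Fin m → ℝ) :
    matDeriv (fun q' => M q' + c • N q') q w = matDeriv M q w + c • matDeriv N q w := by
  ext i j
  simp only [matDeriv_apply, Matrix.add_apply, Matrix.smul_apply, smul_eq_mul]
  rw [fderiv_fun_add (hM i j) ((hN i j).const_mul c), fderiv_const_mul (hN i j)]
  simp

lemma matDeriv_mul {m n : ℕ} {M N : (Fin m → ℝ) → Matrix (Fin n) (Fin n) ℝ}
    {q : Fin m → ℝ} (hM : MatDifferentiableAt M q) (hN : MatDifferentiableAt N q)
    (w : Fin m → ℝ) :
    matDeriv (fun q' => M q' * N q') q w = matDeriv M q w * N q + M q * matDeriv N q w := by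
  ext i j
  simp only [matDeriv_apply, Matrix.add_apply, Matrix.mul_apply]
  rw [fderiv_fun_sum fun k _ => (hM i k).fun_mul (hN k j), ← Finset.sum_add_distrib]
  simp only [_root_.sum_apply]
  refine Finset.sum_congr rfl fun k _ => ?_
  rw [fderiv_fun_mul (hM i k) (hN k j)]
  simp
  ring

lemma matDeriv_congr {m n : ℕ} {M N : (Fin m → ℝ) → Matrix (Fin n) (Fin n) ℝ}
    {q : Fin m → ℝ} (h : ∀ᶠ q' in nhds q, M q' = N q') (w : Fin m → ℝ) :
    matDeriv M q w = matDeriv N q w := by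
  ext i j
  simp only [matDeriv_apply]
  rw [Filter.EventuallyEq.fderiv_eq (h.mono fun q' hq' => by rw [hq'])]

lemma MatDifferentiableAt.fderiv_det {m n : ℕ}
    {M : (Fin m → ℝ) → Matrix (Fin n) (Fin n) ℝ} {q : Fin m → ℝ}
    (hM : MatDifferentiableAt M q) :
    DifferentiableAt ℝ (fun q' => (M q').det) q ∧
    ∀ w, fderiv ℝ (fun q' => (M q').det) q w = ((M q).adjugate * matDeriv M q w).trace := by
  let D : ContinuousMultilinearMap ℝ (fun _ : Fin n => Fin n → ℝ) ℝ :=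
    { toMultilinearMap := (Matrix.detRowAlternating (n := Fin n) (R := ℝ)).toMultilinearMap
      cont := Continuous.matrix_det (A := fun x : Fin n → Fin n → ℝ => (Matrix.of x)) continuous_id }
  have h1 : HasFDerivAt (fun q' => (fun i j => M q' i j : Fin n → Fin n → ℝ))
      (ContinuousLinearMap.pi fun i => ContinuousLinearMap.pi fun j =>
        fderiv ℝ (fun q' => M q' i j) q) q :=
    hasFDerivAt_pi.2 fun i => hasFDerivAt_pi.2 fun j => (hM i j).hasFDerivAt
  have h2 := (D.hasFDerivAt (fun i j => M q i j)).comp q h1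
  have h3 : HasFDerivAt (fun q' => (M q').det) _ q := h2
  refine ⟨h3.differentiableAt, fun w => ?_⟩
  rw [h3.fderiv, ContinuousLinearMap.comp_apply, ContinuousMultilinearMap.linearDeriv_apply,
    Matrix.trace_mul_comm]
  refine Finset.sum_congr rfl fun i _ => ?_
  have : D (Function.update (fun i j => M q i j) i (fun j => matDeriv M q w i j))
      = ((M q).updateRow i (fun j => matDeriv M q w i j)).det := rfl
  refine this.trans ?_
  rw [← Matrix.cramer_transpose_apply, Matrix.cramer_eq_adjugate_mulVec,
    ← Matrix.adjugate_transpose]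
  simp [Matrix.diag, Matrix.mul_apply, Matrix.mulVec, dotProduct, mul_comm]

lemma MatDifferentiableAt.adjugate {m n : ℕ}
    {M : (Fin m → ℝ) → Matrix (Fin n) (Fin n) ℝ} {q : Fin m → ℝ}
    (hM : MatDifferentiableAt M q) : MatDifferentiableAt (fun q' => (M q').adjugate) q := by
  intro i j
  simp only [Matrix.adjugate_apply]
  refine (MatDifferentiableAt.fderiv_det (M := fun q' => (M q').updateRow j (Pi.single i 1))
    fun k l => ?_).1
  by_cases h : k = j
  · subst h; simp
  · simpa [Matrix.updateRow_ne h] using hM k l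

lemma MatDifferentiableAt.inv {m n : ℕ}
    {M : (Fin m → ℝ) → Matrix (Fin n) (Fin n) ℝ} {q : Fin m → ℝ}
    (hM : MatDifferentiableAt M q) (h : (M q).det ≠ 0) :
    MatDifferentiableAt (fun q' => (M q')⁻¹) q := by
  intro i j
  simp only [Matrix.inv_def, Matrix.smul_apply, smul_eq_mul, Ring.inverse_eq_inv']
  exact (hM.fderiv_det.1.fun_inv h).fun_mul (hM.adjugate i j)

lemma eventually_det_ne_zero {m n : ℕ}
    {M : (Fin m → ℝ) → Matrix (Fin n) (Fin n) ℝ} {q : Fin m → ℝ}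
    (hM : MatDifferentiableAt M q) (h : (M q).det ≠ 0) : ∀ᶠ q' in nhds q, (M q').det ≠ 0 :=
  hM.fderiv_det.1.continuousAt.eventually_ne h

lemma matDeriv_const {m n : ℕ} (N : Matrix (Fin n) (Fin n) ℝ) (q w : Fin m → ℝ) :
    matDeriv (fun _ => N) q w = 0 := by
  ext i j
  simp [matDeriv_apply]

lemma matDeriv_inv {m n : ℕ}
    {M : (Fin m → ℝ) → Matrix (Fin n) (Fin n) ℝ} {q : Fin m → ℝ}
    (hM : MatDifferentiableAt M q) (h : (M q).det ≠ 0) (w : Fin m → ℝ) :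
    matDeriv (fun q' => (M q')⁻¹) q w = -((M q)⁻¹ * matDeriv M q w * (M q)⁻¹) := by
  have h1 := matDeriv_mul hM (hM.inv h) w
  rw [matDeriv_congr (N := fun _ => 1) ((eventually_det_ne_zero hM h).mono fun q' hq' =>
    Matrix.mul_nonsing_inv _ (isUnit_iff_ne_zero.2 hq')) w, matDeriv_const] at h1
  have h2 := congrArg (fun X => (M q)⁻¹ * X) h1
  simp only [Matrix.mul_add, Matrix.mul_zero] at h2
  rw [← Matrix.mul_assoc _ (M q), Matrix.nonsing_inv_mul _ (isUnit_iff_ne_zero.2 h),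
    Matrix.one_mul, ← Matrix.mul_assoc] at h2
  exact eq_neg_of_add_eq_zero_right h2.symm

lemma matDeriv_adjugate {m n : ℕ}
    {M : (Fin m → ℝ) → Matrix (Fin n) (Fin n) ℝ} {q : Fin m → ℝ}
    (hM : MatDifferentiableAt M q) (h : (M q).det ≠ 0) (w : Fin m → ℝ) :
    matDeriv (fun q' => (M q').adjugate) q w =
      (M q)⁻¹ * (((M q).adjugate * matDeriv M q w).trace • 1
        - matDeriv M q w * (M q).adjugate) := by
  have h1 := matDeriv_mul hM hM.adjugate w
  have h0 : matDeriv (fun q' => M q' * (M q').adjugate) q w =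
      ((M q).adjugate * matDeriv M q w).trace • 1 := by
    rw [← hM.fderiv_det.2 w]
    ext i j
    simp only [matDeriv_apply, Matrix.mul_adjugate, Matrix.smul_apply, smul_eq_mul]
    rw [fderiv_mul_const hM.fderiv_det.1]
    simp [mul_comm]
  rw [← h0, h1, add_sub_cancel_left, ← Matrix.mul_assoc,
    Matrix.nonsing_inv_mul _ (isUnit_iff_ne_zero.2 h), Matrix.one_mul]

/-- The connection matrix `w^h Γ^i_{hl}` in the direction `w`. -/
def connection {n : ℕ} (g : (Fin n → ℝ) → Matrix (Fin n) (Fin n) ℝ)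
    (q w : Fin n → ℝ) : Matrix (Fin n) (Fin n) ℝ :=
  Matrix.of fun i l => ∑ h, w h * christoffel g i h l q

lemma ncBracket_eq {n : ℕ} (J : (Fin n → ℝ) → Matrix (Fin n) (Fin n) ℝ)
    (f h : (Fin n → ℝ) → (Fin n → ℝ) → ℝ) (q p u v : Fin n → ℝ)
    (hu : ∀ i, pd (fun p' => f q p') i p = u i) (hv : ∀ i, pd (fun p' => h q p') i p = v i) :
    ncBracket J f h q p =
      fderiv ℝ (fun q' => f q' p) q (J q *ᵥ v) - fderiv ℝ (fun q' => h q' p) q (J q *ᵥ u)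
        + (p ⬝ᵥ (matDeriv J q v *ᵥ u) - p ⬝ᵥ (matDeriv J q u *ᵥ v)) := by
  simp only [ncBracket, hu, hv]
  congr 1
  · congr 1
    · rw [fderiv_eq_sum_pd]
      simp [Matrix.mulVec, dotProduct, Finset.mul_sum, mul_assoc]
    · rw [fderiv_eq_sum_pd, Finset.sum_comm]
      simp only [Matrix.mulVec, dotProduct, Finset.mul_sum]
      exact Finset.sum_congr rfl fun _ _ => Finset.sum_congr rfl fun _ _ => by ring
  · have key : ∀ a b : Fin n → ℝ, p ⬝ᵥ (matDeriv J q b *ᵥ a)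
        = ∑ i, ∑ j, ∑ k, a i * (pd (fun q' => J q' k i) j q * p k) * b j := by
      intro a b
      simp only [Matrix.mulVec, dotProduct, matDeriv_apply, fderiv_eq_sum_pd, Finset.mul_sum,
        Finset.sum_mul]
      rw [Finset.sum_comm]
      refine Finset.sum_congr rfl fun i _ => ?_
      rw [Finset.sum_comm]
      exact Finset.sum_congr rfl fun _ _ => Finset.sum_congr rfl fun _ _ => by ring
    rw [key, key, Finset.sum_comm (f := fun i j => ∑ k, v i * _ * _), ← Finset.sum_sub_distrib]
    refine Finset.sum_congr rfl fun i _ => ?_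
    rw [← Finset.sum_sub_distrib]
    refine Finset.sum_congr rfl fun j _ => ?_
    rw [← Finset.sum_sub_distrib, Omega, Finset.mul_sum, Finset.sum_mul]
    exact Finset.sum_congr rfl fun k _ => by ring

lemma christoffel_symm {n : ℕ} {g : (Fin n → ℝ) → Matrix (Fin n) (Fin n) ℝ} {q : Fin n → ℝ}
    (hsym : ∀ᶠ q' in nhds q, (g q').IsSymm) (i j k : Fin n) :
    christoffel g i j k q = christoffel g i k j q := by
  have h : ∀ l, pd (fun q' => g q' j k) l q = pd (fun q' => g q' k j) l q := fun l => by
    unfold pd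
    rw [Filter.EventuallyEq.fderiv_eq (hsym.mono fun q' hq' => hq'.apply k j)]
  unfold christoffel
  congr 1
  refine Finset.sum_congr rfl fun l _ => ?_
  rw [h l]
  ring

lemma connection_mulVec_comm {n : ℕ} {g : (Fin n → ℝ) → Matrix (Fin n) (Fin n) ℝ}
    {q : Fin n → ℝ} (hsym : ∀ᶠ q' in nhds q, (g q').IsSymm) (u w : Fin n → ℝ) :
    connection g q w *ᵥ u = connection g q u *ᵥ w := by
  ext i
  simp only [connection, Matrix.mulVec, dotProduct, Matrix.of_apply, Finset.sum_mul]
  rw [Finset.sum_comm]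
  refine Finset.sum_congr rfl fun l _ => Finset.sum_congr rfl fun h _ => ?_
  rw [christoffel_symm hsym]
  ring

lemma sum_mul_christoffel {n : ℕ} {g : (Fin n → ℝ) → Matrix (Fin n) (Fin n) ℝ}
    {q : Fin n → ℝ} (hdet : (g q).det ≠ 0) (i h k : Fin n) :
    ∑ l, g q i l * christoffel g l h k q = (1 / 2) *
      (pd (fun q' => g q' i k) h q + pd (fun q' => g q' i h) k q
        - pd (fun q' => g q' h k) i q) := by
  have h1 : (fun l => christoffel g l h k q) = (1 / 2 : ℝ) • ((g q)⁻¹ *ᵥ fun l =>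
      (pd (fun q' => g q' l k) h q + pd (fun q' => g q' l h) k q
        - pd (fun q' => g q' h k) l q)) := by
    ext l
    simp [christoffel, Matrix.mulVec, dotProduct]
  have h2 := congrArg (fun x => (g q *ᵥ x) i) h1
  simp only [Matrix.mulVec_smul, Matrix.mulVec_mulVec,
    Matrix.mul_nonsing_inv _ (isUnit_iff_ne_zero.2 hdet), Matrix.one_mulVec] at h2
  simpa [Matrix.mulVec, dotProduct] using h2

lemma matDeriv_metric {n : ℕ} {g : (Fin n → ℝ) → Matrix (Fin n) (Fin n) ℝ}
    {q : Fin n → ℝ} (hsym : ∀ᶠ q' in nhds q, (g q').IsSymm) (hdet : (g q).det ≠ 0)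
    (w : Fin n → ℝ) :
    matDeriv g q w = (connection g q w)ᵀ * g q + g q * connection g q w := by
  have hs : ∀ i j l, pd (fun q' => g q' i j) l q = pd (fun q' => g q' j i) l q :=
    fun i j l => by
      unfold pd
      rw [Filter.EventuallyEq.fderiv_eq (hsym.mono fun q' hq' => hq'.apply j i)]
  have hlow : ∀ i k, (g q * connection g q w) i k =
      ∑ h, w h * ∑ l, g q i l * christoffel g l h k q := by
    intro i k
    simp only [Matrix.mul_apply, connection, Matrix.of_apply, Finset.mul_sum]
    rw [Finset.sum_comm]
    exact Finset.sum_congr rfl fun _ _ => Finset.sum_congr rfl fun _ _ => by ring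
  have htr : (connection g q w)ᵀ * g q = (g q * connection g q w)ᵀ := by
    rw [Matrix.transpose_mul, hsym.self_of_nhds.eq]
  ext i k
  rw [htr, Matrix.add_apply, Matrix.transpose_apply, hlow, hlow, matDeriv_apply,
    fderiv_eq_sum_pd, ← Finset.sum_add_distrib]
  refine Finset.sum_congr rfl fun h _ => ?_
  rw [sum_mul_christoffel hdet, sum_mul_christoffel hdet, hs k i, hs h k, hs h i]
  ring

/-- The coordinate form of `∇_w J = w ⊗ α + α^♯ ⊗ w^♭`. -/
lemma matDeriv_eq_of_covDeriv {n : ℕ} {g J : (Fin n → ℝ) → Matrix (Fin n) (Fin n) ℝ}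
    {q α : Fin n → ℝ}
    (hα : ∀ h i j, covDeriv g J h i j q =
      α j * (if i = h then (1 : ℝ) else 0) + (∑ k, (g q)⁻¹ i k * α k) * g q j h)
    (w : Fin n → ℝ) :
    matDeriv J q w = vecMulVec w α + vecMulVec ((g q)⁻¹ *ᵥ α) (g q *ᵥ w)
      - connection g q w * J q + J q * connection g q w := by
  ext i j
  have h1 : ∀ h, pd (fun q' => J q' i j) h q * w h =
      w h * (α j * (if i = h then (1 : ℝ) else 0)) +
        ((g q)⁻¹ *ᵥ α) i * (g q j h * w h)
      - ∑ l, w h * christoffel g i h l q * J q l j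
      + ∑ l, J q i l * (w h * christoffel g l h j q) := by
    intro h
    have h2 := hα h i j
    have h3 : ∑ l, w h * christoffel g i h l q * J q l j
        = w h * ∑ l, christoffel g i h l q * J q l j := by
      rw [Finset.mul_sum]
      exact Finset.sum_congr rfl fun _ _ => by ring
    have h4 : ∑ l, J q i l * (w h * christoffel g l h j q)
        = w h * ∑ l, christoffel g l h j q * J q i l := by
      rw [Finset.mul_sum]
      exact Finset.sum_congr rfl fun _ _ => by ring
    have h5 : ((g q)⁻¹ *ᵥ α) i = ∑ k, (g q)⁻¹ i k * α k := rfl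
    rw [h3, h4, h5]
    unfold covDeriv at h2
    linear_combination w h * h2
  simp only [matDeriv_apply, fderiv_eq_sum_pd, h1, Finset.sum_add_distrib,
    Finset.sum_sub_distrib, Matrix.add_apply, Matrix.sub_apply, vecMulVec_apply]
  congr 1
  · congr 1
    · congr 1
      · simp
      · rw [← Finset.mul_sum]; rfl
    · rw [Finset.sum_comm]
      simp [Matrix.mul_apply, connection, Finset.sum_mul]
  · rw [Finset.sum_comm]
    simp [Matrix.mul_apply, connection, Finset.mul_sum]

lemma adjugate_eq_det_smul_inv {n : ℕ} {A : Matrix (Fin n) (Fin n) ℝ} (hA : A.det ≠ 0) :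
    A.adjugate = A.det • A⁻¹ := by
  rw [Matrix.inv_def, smul_smul, Ring.inverse_eq_inv', mul_inv_cancel₀ hA, one_smul]

lemma inv_mul_isSymm {n : ℕ} {A G : Matrix (Fin n) (Fin n) ℝ} (hG : G.IsSymm)
    (hAG : (A * G).IsSymm) (hA : A.det ≠ 0) : (A⁻¹ * G).IsSymm := by
  have h1 : G * Aᵀ = A * G := by
    have := hAG.eq
    rwa [Matrix.transpose_mul, hG.eq] at this
  have hAt : Aᵀ * A⁻¹ᵀ = 1 := by
    rw [← Matrix.transpose_mul, Matrix.nonsing_inv_mul _ (isUnit_iff_ne_zero.2 hA),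
      Matrix.transpose_one]
  rw [Matrix.IsSymm, Matrix.transpose_mul, hG.eq]
  calc G * A⁻¹ᵀ = A⁻¹ * (A * G) * A⁻¹ᵀ := by
        rw [← Matrix.mul_assoc, Matrix.nonsing_inv_mul _ (isUnit_iff_ne_zero.2 hA),
          Matrix.one_mul]
    _ = A⁻¹ * G := by
        rw [← h1, ← Matrix.mul_assoc, Matrix.mul_assoc _ Aᵀ, hAt, Matrix.mul_one]

lemma adjugate_mul_isSymm {n : ℕ} {A G : Matrix (Fin n) (Fin n) ℝ} (hG : G.IsSymm)
    (hAG : (A * G).IsSymm) (hA : A.det ≠ 0) : (A.adjugate * G).IsSymm := by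
  rw [adjugate_eq_det_smul_inv hA, Matrix.smul_mul, Matrix.IsSymm, Matrix.transpose_smul,
    (inv_mul_isSymm hG hAG hA).eq]

/-- The quadratic form of the derivative of `cof A · G` at a point, for `A` with the derivative
of a `J`-tensor. -/
lemma dotProduct_deriv_adjugate_mul {n : ℕ} {A dA g G Γ : Matrix (Fin n) (Fin n) ℝ}
    {α w : Fin n → ℝ} (hgG : g * G = 1) (hG : G.IsSymm) (hAG : (A * G).IsSymm)
    (hA : A.det ≠ 0)
    (hdA : dA = vecMulVec w α + vecMulVec (G *ᵥ α) (g *ᵥ w) - Γ * A + A * Γ)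
    (p x : Fin n → ℝ) (hx : x = A⁻¹ *ᵥ (G *ᵥ p)) :
    p ⬝ᵥ ((A⁻¹ * ((A.adjugate * dA).trace • 1 - dA * A.adjugate) * G
        + A.adjugate * -(G * (Γᵀ * g + g * Γ) * G)) *ᵥ p) =
      2 * A.det * ((α ⬝ᵥ (A⁻¹ *ᵥ w)) * (p ⬝ᵥ x) - (p ⬝ᵥ (A⁻¹ *ᵥ w)) * (α ⬝ᵥ x)
        - p ⬝ᵥ (Γ *ᵥ x)) := by
  have hBA : A⁻¹ * A = 1 := Matrix.nonsing_inv_mul _ (isUnit_iff_ne_zero.2 hA)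
  have hAB : A * A⁻¹ = 1 := Matrix.mul_nonsing_inv _ (isUnit_iff_ne_zero.2 hA)
  have hGg : G * g = 1 := mul_eq_one_comm.1 hgG
  have hBG : (A⁻¹ * G).IsSymm := inv_mul_isSymm hG hAG hA
  rw [adjugate_eq_det_smul_inv hA]
  generalize A⁻¹ = B at *
  have e1 : ∀ a b : Fin n → ℝ, a ⬝ᵥ (B *ᵥ (G *ᵥ b)) = b ⬝ᵥ (B *ᵥ (G *ᵥ a)) := by
    intro a b
    rw [Matrix.mulVec_mulVec, Matrix.dotProduct_mulVec, ← Matrix.mulVec_transpose, hBG.eq,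
      dotProduct_comm, Matrix.mulVec_mulVec]
  have e2 : G *ᵥ (g *ᵥ w) = w := by rw [Matrix.mulVec_mulVec, hGg, Matrix.one_mulVec]
  have htr : (B * dA).trace = 2 * (α ⬝ᵥ (B *ᵥ w)) := by
    have h3 : (B * (Γ * A)).trace = (B * (A * Γ)).trace := by
      rw [← Matrix.mul_assoc, Matrix.trace_mul_comm, ← Matrix.mul_assoc, ← Matrix.mul_assoc,
        hAB, hBA]
    rw [hdA, Matrix.mul_add, Matrix.mul_sub, Matrix.mul_add, Matrix.trace_add, Matrix.trace_sub,
      h3, Matrix.trace_add, Matrix.mul_vecMulVec, Matrix.mul_vecMulVec, Matrix.trace_vecMulVec,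
      Matrix.trace_vecMulVec, dotProduct_comm (B *ᵥ (G *ᵥ α)), ← e1, e2, dotProduct_comm]
    ring
  have e3 : (g *ᵥ w) ⬝ᵥ x = p ⬝ᵥ (B *ᵥ w) := by rw [hx, e1, e2]
  have hmid : dA *ᵥ x = (α ⬝ᵥ x) • w + (p ⬝ᵥ (B *ᵥ w)) • (G *ᵥ α) - Γ *ᵥ (G *ᵥ p)
      + A *ᵥ (Γ *ᵥ x) := by
    have e4 : A *ᵥ x = G *ᵥ p := by rw [hx, Matrix.mulVec_mulVec, hAB, Matrix.one_mulVec]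
    rw [hdA, Matrix.add_mulVec, Matrix.sub_mulVec, Matrix.add_mulVec, Matrix.vecMulVec_mulVec,
      Matrix.vecMulVec_mulVec, e3, ← Matrix.mulVec_mulVec, e4, ← Matrix.mulVec_mulVec]
    simp
  have h5 : (G * (Γᵀ * g + g * Γ) * G) *ᵥ p = G *ᵥ (Γᵀ *ᵥ p) + Γ *ᵥ (G *ᵥ p) := by
    have : G * (Γᵀ * g + g * Γ) * G = G * Γᵀ + Γ * G := by
      rw [Matrix.mul_add, Matrix.add_mul, ← Matrix.mul_assoc, ← Matrix.mul_assoc, hGg,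
        Matrix.one_mul, Matrix.mul_assoc _ g, hgG, Matrix.mul_one]
    rw [this, Matrix.add_mulVec, ← Matrix.mulVec_mulVec, ← Matrix.mulVec_mulVec]
  have h6 : p ⬝ᵥ (B *ᵥ (G *ᵥ (Γᵀ *ᵥ p))) = p ⬝ᵥ (Γ *ᵥ x) := by
    rw [e1, ← hx, Matrix.mulVec_transpose, ← Matrix.dotProduct_mulVec]
  have h7 : p ⬝ᵥ (B *ᵥ (G *ᵥ α)) = α ⬝ᵥ x := by rw [e1, hx]
  have h8 : B *ᵥ (A *ᵥ (Γ *ᵥ x)) = Γ *ᵥ x := by rw [Matrix.mulVec_mulVec, hBA, Matrix.one_mulVec]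
  have hL : (B * ((A.det • B * dA).trace • 1 - dA * A.det • B) * G
        + A.det • B * -(G * (Γᵀ * g + g * Γ) * G)) *ᵥ p =
      A.det • ((B * dA).trace • x - B *ᵥ (dA *ᵥ x)
        - B *ᵥ ((G * (Γᵀ * g + g * Γ) * G) *ᵥ p)) := by
    rw [hx]
    simp only [Matrix.add_mulVec, Matrix.mulVec_mulVec, Matrix.mul_neg, Matrix.neg_mulVec,
      Matrix.mul_sub, Matrix.sub_mul, Matrix.sub_mulVec, Matrix.smul_mul, Matrix.mul_smul,
      Matrix.smul_mulVec, Matrix.trace_smul, Matrix.mul_one, smul_sub, smul_smul, smul_eq_mul,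
      Matrix.mul_assoc]
    abel
  rw [hL, htr, hmid, h5]
  simp only [Matrix.mulVec_add, Matrix.mulVec_sub, Matrix.mulVec_smul, dotProduct_add,
    dotProduct_sub, dotProduct_smul, h6, h7, h8, smul_eq_mul]
  ring

lemma inv_mul_mul_inv_comm {n : ℕ} {A B J : Matrix (Fin n) (Fin n) ℝ} (hJ : J.det ≠ 0)
    (h : A * J⁻¹ * B = B * J⁻¹ * A) : A⁻¹ * J * B⁻¹ = B⁻¹ * J * A⁻¹ := by
  have h1 := congrArg (fun X => X⁻¹) h
  simp only [Matrix.mul_inv_rev, Matrix.nonsing_inv_nonsing_inv _ (isUnit_iff_ne_zero.2 hJ)] at h1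
  rw [Matrix.mul_assoc, Matrix.mul_assoc, h1]

lemma pencil_inv_mul_mul_inv_comm {n : ℕ} {J₁ J₂ : Matrix (Fin n) (Fin n) ℝ}
    (h₁ : J₁.det ≠ 0) (a b : ℝ) :
    (J₂ + a • J₁)⁻¹ * J₁ * (J₂ + b • J₁)⁻¹ = (J₂ + b • J₁)⁻¹ * J₁ * (J₂ + a • J₁)⁻¹ := by
  refine inv_mul_mul_inv_comm h₁ ?_
  have e := Matrix.nonsing_inv_mul _ (isUnit_iff_ne_zero.2 h₁)
  have e' := Matrix.mul_nonsing_inv _ (isUnit_iff_ne_zero.2 h₁)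
  simp only [Matrix.add_mul, Matrix.mul_add, Matrix.smul_mul, Matrix.mul_smul, Matrix.mul_assoc,
    e, e', Matrix.mul_one, Matrix.one_mul]
  module

lemma pencil_inv_mul_mul_inv_comm' {n : ℕ} {J₁ J₂ : Matrix (Fin n) (Fin n) ℝ}
    (h₂ : J₂.det ≠ 0) (a b : ℝ) :
    (J₂ + a • J₁)⁻¹ * J₂ * (J₂ + b • J₁)⁻¹ = (J₂ + b • J₁)⁻¹ * J₂ * (J₂ + a • J₁)⁻¹ := by
  refine inv_mul_mul_inv_comm h₂ ?_
  have e := Matrix.nonsing_inv_mul _ (isUnit_iff_ne_zero.2 h₂)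
  have e' := Matrix.mul_nonsing_inv _ (isUnit_iff_ne_zero.2 h₂)
  simp only [Matrix.add_mul, Matrix.mul_add, Matrix.smul_mul, Matrix.mul_smul, Matrix.mul_assoc,
    e, e', Matrix.mul_one, Matrix.one_mul]
  module

lemma connection_smul {n : ℕ} (g : (Fin n → ℝ) → Matrix (Fin n) (Fin n) ℝ)
    (q w : Fin n → ℝ) (c : ℝ) : connection g q (c • w) = c • connection g q w := by
  ext i l
  simp [connection, Finset.mul_sum, mul_assoc]

/-- The symmetry in `(A, B)` of the horizontal part of the bracket of two cofactor quadratic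
forms, given the scalar identity `hs` between the structure one-forms. -/
lemma bracket_pair_symm {n : ℕ} {g J : (Fin n → ℝ) → Matrix (Fin n) (Fin n) ℝ} {q : Fin n → ℝ}
    (hsym : ∀ᶠ q' in nhds q, (g q').IsSymm) {G dJx dJy B C : Matrix (Fin n) (Fin n) ℝ}
    {α β γ p x y : Fin n → ℝ} {a b : ℝ}
    (hdJx : dJx = vecMulVec (a • x) γ + vecMulVec (G *ᵥ γ) (g q *ᵥ (a • x))
      - connection g q (a • x) * J q + J q * connection g q (a • x))
    (hdJy : dJy = vecMulVec (b • y) γ + vecMulVec (G *ᵥ γ) (g q *ᵥ (b • y))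
      - connection g q (b • y) * J q + J q * connection g q (b • y))
    (hz : B *ᵥ (J q *ᵥ y) = C *ᵥ (J q *ᵥ x))
    (hs : (α ⬝ᵥ (B *ᵥ (J q *ᵥ y))) * (p ⬝ᵥ x) - (p ⬝ᵥ (B *ᵥ (J q *ᵥ y))) * (α ⬝ᵥ x)
        + (p ⬝ᵥ y) * (γ ⬝ᵥ x) =
      (β ⬝ᵥ (B *ᵥ (J q *ᵥ y))) * (p ⬝ᵥ y) - (p ⬝ᵥ (B *ᵥ (J q *ᵥ y))) * (β ⬝ᵥ y)
        + (p ⬝ᵥ x) * (γ ⬝ᵥ y)) :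
    a * ((α ⬝ᵥ (B *ᵥ (J q *ᵥ (b • y)))) * (p ⬝ᵥ x)
        - (p ⬝ᵥ (B *ᵥ (J q *ᵥ (b • y)))) * (α ⬝ᵥ x)
        - p ⬝ᵥ (connection g q (J q *ᵥ (b • y)) *ᵥ x)) + p ⬝ᵥ (dJy *ᵥ (a • x)) =
    b * ((β ⬝ᵥ (C *ᵥ (J q *ᵥ (a • x)))) * (p ⬝ᵥ y)
        - (p ⬝ᵥ (C *ᵥ (J q *ᵥ (a • x)))) * (β ⬝ᵥ y)
        - p ⬝ᵥ (connection g q (J q *ᵥ (a • x)) *ᵥ y)) + p ⬝ᵥ (dJx *ᵥ (b • y)) := by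
  have hg : (g q *ᵥ x) ⬝ᵥ y = (g q *ᵥ y) ⬝ᵥ x := by
    rw [← Matrix.vecMul_transpose, hsym.self_of_nhds.eq, ← Matrix.dotProduct_mulVec,
      dotProduct_comm]
  have c1 := connection_mulVec_comm hsym x (J q *ᵥ y)
  have c2 := connection_mulVec_comm hsym y (J q *ᵥ x)
  have c3 := connection_mulVec_comm hsym x y
  have key : ∀ (s t : ℝ) (v w : Fin n → ℝ), p ⬝ᵥ ((vecMulVec (s • v) γ
        + vecMulVec (G *ᵥ γ) (g q *ᵥ (s • v))
        - connection g q (s • v) * J q + J q * connection g q (s • v)) *ᵥ (t • w)) =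
      s * t * ((p ⬝ᵥ v) * (γ ⬝ᵥ w) + (p ⬝ᵥ (G *ᵥ γ)) * ((g q *ᵥ v) ⬝ᵥ w)
        - p ⬝ᵥ (connection g q v *ᵥ (J q *ᵥ w)) + p ⬝ᵥ (J q *ᵥ (connection g q v *ᵥ w))) := by
    intro s t v w
    simp only [connection_smul, Matrix.add_mulVec, Matrix.sub_mulVec, Matrix.vecMulVec_mulVec,
      ← Matrix.mulVec_mulVec, Matrix.mulVec_smul, Matrix.smul_mulVec, dotProduct_add,
      dotProduct_sub, dotProduct_smul, smul_dotProduct, smul_eq_mul, op_smul_eq_smul]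
    ring
  rw [hdJx, hdJy, key, key]
  simp only [Matrix.mulVec_smul, connection_smul, Matrix.smul_mulVec, dotProduct_smul,
    smul_eq_mul, c1, c2, ← c3, ← hz, hg]
  linear_combination a * b * hs

lemma pd_quadratic {n : ℕ} {M : Matrix (Fin n) (Fin n) ℝ} (hM : M.IsSymm) (c : ℝ)
    (p : Fin n → ℝ) (i : Fin n) :
    pd (fun p' => (1 / 2) * (p' ⬝ᵥ (M *ᵥ p')) + c) i p = (M *ᵥ p) i := by
  have h : HasFDerivAt (fun p' : Fin n → ℝ => (1 / 2) * (∑ k, ∑ l, p' k * (M k l * p' l)) + c)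
      ((1 / 2 : ℝ) • ∑ k, ∑ l, (p k • (M k l • ContinuousLinearMap.proj (R := ℝ) l)
        + (M k l * p l) • ContinuousLinearMap.proj (R := ℝ) (φ := fun _ : Fin n => ℝ) k)) p :=
    ((HasFDerivAt.fun_sum fun k _ => HasFDerivAt.fun_sum fun l _ =>
      (hasFDerivAt_apply k p).fun_mul ((hasFDerivAt_apply l p).const_mul (M k l))).const_mul
        _).add_const c
  have h' : (fun p' : Fin n → ℝ => (1 / 2) * (p' ⬝ᵥ (M *ᵥ p')) + c) =
      fun p' => (1 / 2) * (∑ k, ∑ l, p' k * (M k l * p' l)) + c := by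
    ext p'
    simp [Matrix.mulVec, dotProduct, Finset.mul_sum]
  rw [pd, h', h.fderiv]
  have e1 : ∑ k, p k * M k i = (M *ᵥ p) i := by
    simp only [Matrix.mulVec, dotProduct]
    exact Finset.sum_congr rfl fun k _ => by rw [hM.apply i k, mul_comm]
  simp only [_root_.smul_apply, _root_.sum_apply, _root_.add_apply,
    ContinuousLinearMap.proj_apply, Finset.sum_add_distrib, smul_eq_mul, Pi.single_apply,
    mul_ite, mul_one, mul_zero, Finset.sum_ite_eq', Finset.mem_univ, if_true]
  rw [e1, Finset.sum_comm]
  simp only [Finset.sum_ite_eq', Finset.mem_univ, if_true]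
  change 1 / 2 * ((M *ᵥ p) i + (M *ᵥ p) i) = _
  ring

lemma fderiv_dotProduct_mulVec {m n : ℕ} {M : (Fin m → ℝ) → Matrix (Fin n) (Fin n) ℝ}
    {q : Fin m → ℝ} (hM : MatDifferentiableAt M q) (p : Fin n → ℝ) :
    DifferentiableAt ℝ (fun q' => p ⬝ᵥ (M q' *ᵥ p)) q ∧
    ∀ w, fderiv ℝ (fun q' => p ⬝ᵥ (M q' *ᵥ p)) q w = p ⬝ᵥ (matDeriv M q w *ᵥ p) := by
  have h : HasFDerivAt (fun q' => ∑ i, p i * ∑ j, M q' i j * p j)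
      (∑ i, p i • ∑ j, p j • fderiv ℝ (fun q' => M q' i j) q) q :=
    HasFDerivAt.fun_sum fun i _ => (HasFDerivAt.fun_sum fun j _ =>
      (hM i j).hasFDerivAt.mul_const (p j)).const_mul (p i)
  have h' : HasFDerivAt (fun q' => p ⬝ᵥ (M q' *ᵥ p)) _ q := h
  refine ⟨h'.differentiableAt, fun w => ?_⟩
  rw [h'.fderiv]
  simp [Matrix.mulVec, dotProduct, matDeriv_apply, mul_comm]

/-- Two quadratic-plus-potential Hamiltonians built from a common family of symmetric tensors
with constant coefficients commute, if the family commutes and the potentials are compatible. -/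
lemma ncBracket_eq_zero_of_family {n : ℕ} {ι : Type*} [Fintype ι]
    {J : (Fin n → ℝ) → Matrix (Fin n) (Fin n) ℝ}
    {T : ι → (Fin n → ℝ) → Matrix (Fin n) (Fin n) ℝ} {q p : Fin n → ℝ}
    (hT : ∀ k, MatDifferentiableAt (T k) q) (hTs : ∀ k, (T k q).IsSymm)
    (hb : ∀ k l,
      (1 / 2) * (p ⬝ᵥ (matDeriv (T k) q (J q *ᵥ (T l q *ᵥ p)) *ᵥ p))
        + p ⬝ᵥ (matDeriv J q (T l q *ᵥ p) *ᵥ (T k q *ᵥ p)) =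
      (1 / 2) * (p ⬝ᵥ (matDeriv (T l) q (J q *ᵥ (T k q *ᵥ p)) *ᵥ p))
        + p ⬝ᵥ (matDeriv J q (T k q *ᵥ p) *ᵥ (T l q *ᵥ p)))
    {c d : ι → ℝ} {φ ψ : (Fin n → ℝ) → ℝ}
    (hφ : DifferentiableAt ℝ φ q) (hψ : DifferentiableAt ℝ ψ q)
    (hpot : fderiv ℝ φ q (J q *ᵥ ((∑ k, d k • T k q) *ᵥ p)) =
      fderiv ℝ ψ q (J q *ᵥ ((∑ k, c k • T k q) *ᵥ p)))
    {f h : (Fin n → ℝ) → (Fin n → ℝ) → ℝ}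
    (hf : ∀ᶠ q' in nhds q, ∀ p, f q' p =
      (1 / 2) * (p ⬝ᵥ ((∑ k, c k • T k q') *ᵥ p)) + φ q')
    (hh : ∀ᶠ q' in nhds q, ∀ p, h q' p =
      (1 / 2) * (p ⬝ᵥ ((∑ k, d k • T k q') *ᵥ p)) + ψ q') :
    ncBracket J f h q p = 0 := by
  have hsum : ∀ (c : ι → ℝ), (∑ k, c k • T k q).IsSymm := fun c => by
    rw [Matrix.IsSymm, Matrix.transpose_sum]
    exact Finset.sum_congr rfl fun k _ => by rw [Matrix.transpose_smul, (hTs k).eq]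
  have hvert : ∀ (f : (Fin n → ℝ) → (Fin n → ℝ) → ℝ) (c : ι → ℝ) (φ : (Fin n → ℝ) → ℝ),
      (∀ᶠ q' in nhds q, ∀ p, f q' p =
        (1 / 2) * (p ⬝ᵥ ((∑ k, c k • T k q') *ᵥ p)) + φ q') →
      ∀ i, pd (fun p' => f q p') i p = ((∑ k, c k • T k q) *ᵥ p) i := by
    intro f c φ hf i
    rw [← pd_quadratic (hsum c) (φ q) p i]
    congr 1
    ext p'
    exact hf.self_of_nhds p'
  have hhor : ∀ (f : (Fin n → ℝ) → (Fin n → ℝ) → ℝ) (c : ι → ℝ) (φ : (Fin n → ℝ) → ℝ),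
      DifferentiableAt ℝ φ q →
      (∀ᶠ q' in nhds q, ∀ p, f q' p =
        (1 / 2) * (p ⬝ᵥ ((∑ k, c k • T k q') *ᵥ p)) + φ q') →
      ∀ w, fderiv ℝ (fun q' => f q' p) q w =
        ∑ k, c k * ((1 / 2) * (p ⬝ᵥ (matDeriv (T k) q w *ᵥ p))) + fderiv ℝ φ q w := by
    intro f c φ hφ hf w
    have e : (fun q' => f q' p) =ᶠ[nhds q]
        fun q' => ∑ k, (c k * (1 / 2)) * (p ⬝ᵥ (T k q' *ᵥ p)) + φ q' := by
      refine hf.mono fun q' hq' => ?_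
      simp only [hq' p, Matrix.sum_mulVec, dotProduct_sum, Matrix.smul_mulVec, dotProduct_smul,
        Finset.mul_sum, smul_eq_mul]
      congr 1
      exact Finset.sum_congr rfl fun _ _ => by ring
    have hd : ∀ k ∈ Finset.univ, DifferentiableAt ℝ
        (fun q' => (c k * (1 / 2)) * (p ⬝ᵥ (T k q' *ᵥ p))) q := fun k _ =>
      (fderiv_dotProduct_mulVec (hT k) p).1.const_mul _
    rw [e.fderiv_eq, fderiv_fun_add (DifferentiableAt.fun_sum hd) hφ, fderiv_fun_sum hd]
    simp only [_root_.add_apply, _root_.sum_apply]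
    congr 1
    refine Finset.sum_congr rfl fun k _ => ?_
    rw [fderiv_const_mul (fderiv_dotProduct_mulVec (hT k) p).1, _root_.smul_apply,
      (fderiv_dotProduct_mulVec (hT k) p).2, smul_eq_mul, mul_assoc]
  rw [ncBracket_eq J f h q p _ _ (hvert f c φ hf) (hvert h d ψ hh),
    hhor f c φ hφ hf, hhor h d ψ hψ hh, hpot]
  have expand : ∀ c d : ι → ℝ,
      ∑ k, c k * ((1 / 2) * (p ⬝ᵥ (matDeriv (T k) q
        (J q *ᵥ ((∑ l, d l • T l q) *ᵥ p)) *ᵥ p)))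
      + p ⬝ᵥ (matDeriv J q ((∑ l, d l • T l q) *ᵥ p) *ᵥ ((∑ k, c k • T k q) *ᵥ p)) =
      ∑ k, ∑ l, c k * d l * ((1 / 2) * (p ⬝ᵥ (matDeriv (T k) q (J q *ᵥ (T l q *ᵥ p)) *ᵥ p))
        + p ⬝ᵥ (matDeriv J q (T l q *ᵥ p) *ᵥ (T k q *ᵥ p))) := by
    intro c d
    simp only [Matrix.sum_mulVec, Matrix.smul_mulVec, Matrix.mulVec_sum, Matrix.mulVec_smul,
      matDeriv_sum_smul, dotProduct_sum, dotProduct_smul, smul_eq_mul]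
    rw [← Finset.sum_add_distrib]
    refine Finset.sum_congr rfl fun k _ => ?_
    simp only [Finset.mul_sum]
    rw [← Finset.sum_add_distrib]
    exact Finset.sum_congr rfl fun l _ => by ring
  have e1 := expand c d
  have e2 := expand d c
  have e3 : ∑ k, ∑ l, d k * c l *
        ((1 / 2) * (p ⬝ᵥ (matDeriv (T k) q (J q *ᵥ (T l q *ᵥ p)) *ᵥ p))
          + p ⬝ᵥ (matDeriv J q (T l q *ᵥ p) *ᵥ (T k q *ᵥ p))) =
      ∑ k, ∑ l, c k * d l *
        ((1 / 2) * (p ⬝ᵥ (matDeriv (T k) q (J q *ᵥ (T l q *ᵥ p)) *ᵥ p))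
          + p ⬝ᵥ (matDeriv J q (T l q *ᵥ p) *ᵥ (T k q *ᵥ p))) := by
    rw [Finset.sum_comm]
    exact Finset.sum_congr rfl fun k _ => Finset.sum_congr rfl fun l _ => by
      rw [hb l k, mul_comm (d l)]
  linear_combination e1 - e2 - e3

lemma exists_injective_pencil_det_ne_zero {n : ℕ} {J₁ J₂ : Matrix (Fin n) (Fin n) ℝ}
    (h : J₂.det ≠ 0) :
    ∃ ξ : Fin n → ℝ, Function.Injective ξ ∧ ∀ k, (J₂ + ξ k • J₁).det ≠ 0 := by
  have hc : Continuous fun t : ℝ => (J₂ + t • J₁).det := by fun_prop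
  have hev : ∀ᶠ t in nhds (0 : ℝ), (J₂ + t • J₁).det ≠ 0 :=
    hc.continuousAt.eventually_ne (by simpa using h)
  have hinf : Set.Infinite {t : ℝ | (J₂ + t • J₁).det ≠ 0} := infinite_of_mem_nhds 0 hev
  refine ⟨fun k => hinf.natEmbedding _ k, fun k l hkl => ?_, fun k =>
    (hinf.natEmbedding _ (k : ℕ)).2⟩
  exact Fin.ext ((hinf.natEmbedding _).injective (Subtype.ext hkl))

/-- The coefficients of a matrix polynomial of degree less than `n` are fixed linear combinations
of its values at `n` distinct nodes. -/
lemma exists_coeff_eq_sum_values {n : ℕ} {ξ : Fin n → ℝ} (hξ : Function.Injective ξ) :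
    ∃ c : ℕ → Fin n → ℝ, ∀ (K : ℕ → Matrix (Fin n) (Fin n) ℝ)
      (F : ℝ → Matrix (Fin n) (Fin n) ℝ),
      (∀ t, F t = ∑ i ∈ Finset.range n, t ^ i • K (n - i)) →
      ∀ r ∈ Finset.Icc 1 n, K r = ∑ k, c r k • F (ξ k) := by
  have hdet := isUnit_iff_ne_zero.2 (Matrix.det_vandermonde_ne_zero_iff.2 hξ)
  refine ⟨fun r k => if hr : n - r < n then (Matrix.vandermonde ξ)⁻¹ ⟨n - r, hr⟩ k else 0,
    fun K F hF r hr => ?_⟩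
  rw [Finset.mem_Icc] at hr
  have hlt : n - r < n := by omega
  simp only [hlt, dif_pos, hF, Finset.sum_range, Finset.smul_sum, smul_smul]
  rw [Finset.sum_comm]
  simp only [← Finset.sum_smul]
  have e : ∀ j : Fin n, ∑ k, (Matrix.vandermonde ξ)⁻¹ ⟨n - r, hlt⟩ k * ξ k ^ (j : ℕ) =
      (1 : Matrix (Fin n) (Fin n) ℝ) ⟨n - r, hlt⟩ j := by
    intro j
    rw [← Matrix.nonsing_inv_mul _ hdet, Matrix.mul_apply]
    rfl
  simp only [e, Matrix.one_apply, ite_smul, one_smul, zero_smul, Finset.sum_ite_eq,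
    Finset.mem_univ, if_true]
  congr 1
  omega

lemma mulVec_dotProduct_eq {n : ℕ} {G g K L J J' : Matrix (Fin n) (Fin n) ℝ} (hg : g.IsSymm)
    (hG : G.IsSymm) (hGg : G * g = 1) (hK : (K * G).IsSymm) (hJ : (J * G).IsSymm)
    (d p : Fin n → ℝ) :
    (g *ᵥ ((K * J) *ᵥ (G *ᵥ d))) ⬝ᵥ (J' *ᵥ ((L * G) *ᵥ p)) =
      d ⬝ᵥ ((J * (K * J' * L) * G) *ᵥ p) := by
  have hK' : G * Kᵀ = K * G := by
    have := hK.eq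
    rwa [Matrix.transpose_mul, hG.eq] at this
  have hJ' : G * Jᵀ = J * G := by
    have := hJ.eq
    rwa [Matrix.transpose_mul, hG.eq] at this
  have e : (g * (K * J * G))ᵀ = J * K := by
    calc (g * (K * J * G))ᵀ = G * Jᵀ * Kᵀ * g := by
          simp only [Matrix.transpose_mul, hG.eq, hg.eq, Matrix.mul_assoc]
      _ = J * (G * Kᵀ) * g := by rw [hJ', Matrix.mul_assoc J]
      _ = J * K := by rw [hK', ← Matrix.mul_assoc, Matrix.mul_assoc _ G, hGg, Matrix.mul_one]
  rw [Matrix.mulVec_mulVec, Matrix.mulVec_mulVec, Matrix.mulVec_mulVec,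
    ← Matrix.vecMul_transpose, ← Matrix.dotProduct_mulVec, Matrix.mul_assoc g, e,
    Matrix.mulVec_mulVec]
  simp only [Matrix.mul_assoc]

/-- The Hamiltonians `H_r` of a bi-cofactor system are in
involution with respect to both noncanonical Poisson structures `Π_nc(J₁)` and
`Π_nc(J₂)`. -/
theorem bicofactor_involution
    (n : ℕ) (U : Set (Fin n → ℝ)) (hU : IsOpen U)
    (g : (Fin n → ℝ) → Matrix (Fin n) (Fin n) ℝ)
    (hg : ∀ i j, ContDiffOn ℝ (⊤ : ℕ∞) (fun q => g q i j) U)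
    (hgsym : ∀ q ∈ U, (g q).IsSymm) (hginv : ∀ q ∈ U, IsUnit (g q).det)
    (J₁ J₂ : (Fin n → ℝ) → Matrix (Fin n) (Fin n) ℝ)
    (hJ₁ : IsJTensor U g J₁) (hJ₂ : IsJTensor U g J₂)
    (hJ₁ns : ∀ q ∈ U, (J₁ q).det ≠ 0) (hJ₂ns : ∀ q ∈ U, (J₂ q).det ≠ 0)
    (σ₁ : (Fin n → ℝ) → ℝ) (hσ₁ : σ₁ = fun q => (J₁ q).det)
    (V W : (Fin n → ℝ) → ℝ) (hV : ContDiffOn ℝ (⊤ : ℕ∞) V U) (hW : ContDiffOn ℝ (⊤ : ℕ∞) W U)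
    -- the bi-cofactor condition
    (hbi : ∀ q ∈ U,
      ((J₁ q).adjugate)⁻¹ *ᵥ grad g V q = ((J₂ q).adjugate)⁻¹ *ᵥ grad g W q)
    -- the Killing tensors K_r defined by cof(J₂ + ξJ₁) = Σ_{i=0}^{n-1} K_{n-i} ξ^i
    (K : ℕ → (Fin n → ℝ) → Matrix (Fin n) (Fin n) ℝ)
    (hK : ∀ q ∈ U, ∀ ξ : ℝ,
      (J₂ q + ξ • J₁ q).adjugate = ∑ i ∈ Finset.range n, ξ ^ i • K (n - i) q)
    -- the potentials V_r with V₁ = V and ∇V_r = (1/σ₁) K_r J₁ ∇V₁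
    (Vr : ℕ → (Fin n → ℝ) → ℝ) (hVr1 : Vr 1 = V)
    (hVrsmooth : ∀ r ∈ Finset.Icc 1 n, ContDiffOn ℝ (⊤ : ℕ∞) (Vr r) U)
    (hVr : ∀ r ∈ Finset.Icc 1 n, ∀ q ∈ U,
      grad g (Vr r) q = (1 / σ₁ q) • ((K r q * J₁ q) *ᵥ grad g (Vr 1) q))
    -- the Hamiltonians H_r
    (Hr : ℕ → (Fin n → ℝ) → (Fin n → ℝ) → ℝ)
    (hHr : ∀ r, Hr r = fun q p =>
      (1 / 2) * (p ⬝ᵥ ((K r q * (g q)⁻¹) *ᵥ p)) + Vr r q) :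
    ∀ q ∈ U, ∀ p : Fin n → ℝ,
      ∀ r ∈ Finset.Icc 1 n, ∀ s ∈ Finset.Icc 1 n,
        ncBracket J₁ (Hr r) (Hr s) q p = 0 ∧ ncBracket J₂ (Hr r) (Hr s) q p = 0 := by
  intro q hq p r hr s hs
  have hU' : U ∈ nhds q := hU.mem_nhds hq
  have hsmooth : ∀ f : (Fin n → ℝ) → ℝ, ContDiffOn ℝ (⊤ : ℕ∞) f U → DifferentiableAt ℝ f q :=
    fun f hf => (hf.contDiffAt hU').differentiableAt (by simp)
  obtain ⟨hJ₁s, hJ₁G, α₁, hα₁⟩ := hJ₁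
  obtain ⟨hJ₂s, hJ₂G, α₂, hα₂⟩ := hJ₂
  have dJ₁ : MatDifferentiableAt J₁ q := fun i j => hsmooth _ (hJ₁s i j)
  have dJ₂ : MatDifferentiableAt J₂ q := fun i j => hsmooth _ (hJ₂s i j)
  have dg : MatDifferentiableAt g q := fun i j => hsmooth _ (hg i j)
  have hgd : (g q).det ≠ 0 := (hginv q hq).ne_zero
  have hsymev : ∀ᶠ q' in nhds q, (g q').IsSymm := Filter.mem_of_superset hU' hgsym
  have hgG : g q * (g q)⁻¹ = 1 := Matrix.mul_nonsing_inv _ (hginv q hq)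
  have hGg : (g q)⁻¹ * g q = 1 := Matrix.nonsing_inv_mul _ (hginv q hq)
  have hGs : ((g q)⁻¹).IsSymm := by
    rw [Matrix.IsSymm, Matrix.transpose_nonsing_inv, (hgsym q hq).eq]
  have m₁ := matDeriv_eq_of_covDeriv (hα₁ q hq)
  have m₂ := matDeriv_eq_of_covDeriv (hα₂ q hq)
  obtain ⟨ξ, hξ, hξd⟩ := exists_injective_pencil_det_ne_zero (J₁ := J₁ q) (hJ₂ns q hq)
  obtain ⟨c, hc⟩ := exists_coeff_eq_sum_values hξ
  have hKc : ∀ q' ∈ U, ∀ r ∈ Finset.Icc 1 n,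
      K r q' = ∑ k, c r k • (J₂ q' + ξ k • J₁ q').adjugate := fun q' hq' =>
    hc (fun r => K r q') (fun t => (J₂ q' + t • J₁ q').adjugate) (hK q' hq')
  set A : Fin n → (Fin n → ℝ) → Matrix (Fin n) (Fin n) ℝ := fun k q' => J₂ q' + ξ k • J₁ q'
    with hAdef
  set T : Fin n → (Fin n → ℝ) → Matrix (Fin n) (Fin n) ℝ :=
    fun k q' => (A k q').adjugate * (g q')⁻¹ with hTdef
  have hAd : ∀ k, (A k q).det ≠ 0 := hξd
  have dA : ∀ k, MatDifferentiableAt (A k) q := fun k => dJ₂.add_const_smul dJ₁ (ξ k)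
  have dT : ∀ k, MatDifferentiableAt (T k) q := fun k => (dA k).adjugate.mul (dg.inv hgd)
  have hAG : ∀ k, (A k q * (g q)⁻¹).IsSymm := fun k => by
    simp only [hAdef]
    rw [Matrix.add_mul, Matrix.smul_mul, Matrix.IsSymm, Matrix.transpose_add,
      Matrix.transpose_smul, (hJ₁G q hq).eq, (hJ₂G q hq).eq]
  have hTs : ∀ k, (T k q).IsSymm := fun k => adjugate_mul_isSymm hGs (hAG k) (hAd k)
  have mA : ∀ k w, matDeriv (A k) q w = vecMulVec w (α₂ q + ξ k • α₁ q)
      + vecMulVec ((g q)⁻¹ *ᵥ (α₂ q + ξ k • α₁ q)) (g q *ᵥ w)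
      - connection g q w * A k q + A k q * connection g q w := fun k w => by
    simp only [hAdef]
    rw [matDeriv_add_const_smul dJ₂ dJ₁, m₁, m₂]
    simp only [vecMulVec_add, Matrix.mulVec_add, Matrix.mulVec_smul, add_vecMulVec,
      vecMulVec_smul, smul_vecMulVec, Matrix.mul_add, Matrix.add_mul, Matrix.smul_mul,
      Matrix.mul_smul]
    module
  set x : Fin n → Fin n → ℝ := fun k => (A k q)⁻¹ *ᵥ ((g q)⁻¹ *ᵥ p) with hx
  have hTp : ∀ k, T k q *ᵥ p = (A k q).det • x k := fun k => by
    simp only [hTdef, hx]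
    rw [adjugate_eq_det_smul_inv (hAd k), ← Matrix.mulVec_mulVec, Matrix.smul_mulVec]
  have hquad : ∀ k w, (1 / 2) * (p ⬝ᵥ (matDeriv (T k) q w *ᵥ p)) =
      (A k q).det * (((α₂ q + ξ k • α₁ q) ⬝ᵥ ((A k q)⁻¹ *ᵥ w)) * (p ⬝ᵥ x k)
        - (p ⬝ᵥ ((A k q)⁻¹ *ᵥ w)) * ((α₂ q + ξ k • α₁ q) ⬝ᵥ x k)
        - p ⬝ᵥ (connection g q w *ᵥ x k)) := fun k w => by
    have h1 := dotProduct_deriv_adjugate_mul hgG hGs (hAG k) (hAd k) (mA k w) p (x k) rfl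
    have h2 : matDeriv (T k) q w = _ := matDeriv_mul (dA k).adjugate (dg.inv hgd) w
    rw [h2, matDeriv_adjugate (dA k) (hAd k), matDeriv_inv dg hgd, matDeriv_metric hsymev hgd,
      h1]
    ring
  have comm₁ : ∀ k l, (A k q)⁻¹ * J₁ q * (A l q)⁻¹ = (A l q)⁻¹ * J₁ q * (A k q)⁻¹ :=
    fun k l => pencil_inv_mul_mul_inv_comm (hJ₁ns q hq) _ _
  have comm₂ : ∀ k l, (A k q)⁻¹ * J₂ q * (A l q)⁻¹ = (A l q)⁻¹ * J₂ q * (A k q)⁻¹ :=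
    fun k l => pencil_inv_mul_mul_inv_comm' (hJ₂ns q hq) _ _
  have hxz : ∀ k l, x k = x l + (ξ l - ξ k) • ((A k q)⁻¹ *ᵥ (J₁ q *ᵥ x l)) := fun k l => by
    have h1 : (A k q)⁻¹ *ᵥ (A l q *ᵥ x l) = x k := by
      simp only [hx]
      rw [Matrix.mulVec_mulVec (M := A l q),
        Matrix.mul_nonsing_inv _ (isUnit_iff_ne_zero.2 (hAd l)), Matrix.one_mulVec]
    have h2 : A l q = A k q + (ξ l - ξ k) • J₁ q := by simp only [hAdef]; module
    rw [← h1, h2, Matrix.add_mulVec, Matrix.mulVec_add, Matrix.mulVec_mulVec,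
      Matrix.nonsing_inv_mul _ (isUnit_iff_ne_zero.2 (hAd k)), Matrix.one_mulVec,
      Matrix.smul_mulVec, Matrix.mulVec_smul]
  have hxz' : ∀ k l, (A k q)⁻¹ *ᵥ (J₂ q *ᵥ x l) =
      x l - ξ k • ((A k q)⁻¹ *ᵥ (J₁ q *ᵥ x l)) := fun k l => by
    have h2 : J₂ q = A k q - ξ k • J₁ q := by simp only [hAdef]; module
    rw [h2, Matrix.sub_mulVec, Matrix.mulVec_sub, Matrix.mulVec_mulVec,
      Matrix.nonsing_inv_mul _ (isUnit_iff_ne_zero.2 (hAd k)), Matrix.one_mulVec,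
      Matrix.smul_mulVec, Matrix.mulVec_smul]
  have main : ∀ (J : (Fin n → ℝ) → Matrix (Fin n) (Fin n) ℝ) (γ : Fin n → ℝ),
      (∀ w, matDeriv J q w = vecMulVec w γ + vecMulVec ((g q)⁻¹ *ᵥ γ) (g q *ᵥ w)
        - connection g q w * J q + J q * connection g q w) →
      (∀ k l, (A k q)⁻¹ * J q * (A l q)⁻¹ = (A l q)⁻¹ * J q * (A k q)⁻¹) →
      (∀ k l, ((α₂ q + ξ k • α₁ q) ⬝ᵥ ((A k q)⁻¹ *ᵥ (J q *ᵥ x l))) * (p ⬝ᵥ x k)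
          - (p ⬝ᵥ ((A k q)⁻¹ *ᵥ (J q *ᵥ x l))) * ((α₂ q + ξ k • α₁ q) ⬝ᵥ x k)
          + (p ⬝ᵥ x l) * (γ ⬝ᵥ x k) =
        ((α₂ q + ξ l • α₁ q) ⬝ᵥ ((A k q)⁻¹ *ᵥ (J q *ᵥ x l))) * (p ⬝ᵥ x l)
          - (p ⬝ᵥ ((A k q)⁻¹ *ᵥ (J q *ᵥ x l))) * ((α₂ q + ξ l • α₁ q) ⬝ᵥ x l)
          + (p ⬝ᵥ x k) * (γ ⬝ᵥ x l)) →
      ncBracket J (Hr r) (Hr s) q p = 0 := by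
    intro J γ hJ hcomm hscal
    have hKcomm : K r q * J q * K s q = K s q * J q * K r q := by
      rw [hKc q hq r hr, hKc q hq s hs]
      simp only [Matrix.sum_mul, Matrix.mul_sum]
      rw [Finset.sum_comm]
      refine Finset.sum_congr rfl fun l _ => Finset.sum_congr rfl fun k _ => ?_
      have := hcomm k l
      rw [adjugate_eq_det_smul_inv (hAd k), adjugate_eq_det_smul_inv (hAd l)]
      simp only [Matrix.smul_mul, Matrix.mul_smul, this]
      module
    have hKT : ∀ q' ∈ U, ∀ r ∈ Finset.Icc 1 n,
        K r q' * (g q')⁻¹ = ∑ k, c r k • T k q' := fun q' hq' r hr => by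
      rw [hKc q' hq' r hr, Matrix.sum_mul]
      simp only [Matrix.smul_mul, hTdef, hAdef]
    have hKs : ∀ r ∈ Finset.Icc 1 n, (K r q * (g q)⁻¹).IsSymm := fun r hr => by
      rw [hKT q hq r hr, Matrix.IsSymm, Matrix.transpose_sum]
      exact Finset.sum_congr rfl fun k _ => by rw [Matrix.transpose_smul, (hTs k).eq]
    have hham : ∀ r ∈ Finset.Icc 1 n, ∀ᶠ q' in nhds q, ∀ p, Hr r q' p =
        (1 / 2) * (p ⬝ᵥ ((∑ k, c r k • T k q') *ᵥ p)) + Vr r q' := fun r hr =>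
      Filter.mem_of_superset hU' fun q' hq' p => by
        simp only [hHr r, hKT q' hq' r hr]
    have hpotd : ∀ r ∈ Finset.Icc 1 n, ∀ w, fderiv ℝ (Vr r) q w = (1 / σ₁ q) *
        ((g q *ᵥ ((K r q * J₁ q) *ᵥ ((g q)⁻¹ *ᵥ fun j => pd (Vr 1) j q))) ⬝ᵥ w) := by
      intro r hr w
      have h1 : (fun j => pd (Vr r) j q) = g q *ᵥ grad g (Vr r) q := by
        rw [grad, Matrix.mulVec_mulVec, hgG, Matrix.one_mulVec]
      have h2 : fderiv ℝ (Vr r) q w = (fun j => pd (Vr r) j q) ⬝ᵥ w := fderiv_eq_sum_pd _ _ _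
      rw [h2, h1, hVr r hr q hq, Matrix.mulVec_smul, smul_dotProduct, smul_eq_mul, grad]
    refine ncBracket_eq_zero_of_family (T := T) (c := c r) (d := c s) dT hTs (fun k l => ?_)
      (hsmooth _ (hVrsmooth r hr)) (hsmooth _ (hVrsmooth s hs)) ?_ (hham r hr) (hham s hs)
    · rw [hquad, hquad, hTp, hTp]
      refine bracket_pair_symm hsymev (hJ _) (hJ _) ?_ (hscal k l)
      simp only [hx, Matrix.mulVec_mulVec]
      rw [← Matrix.mul_assoc, ← Matrix.mul_assoc, hcomm k l]
      simp only [Matrix.mul_assoc]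
    · rw [← hKT q hq r hr, ← hKT q hq s hs, hpotd r hr, hpotd s hs,
        mulVec_dotProduct_eq (hgsym q hq) hGs hGg (hKs r hr) (hJ₁G q hq),
        mulVec_dotProduct_eq (hgsym q hq) hGs hGg (hKs s hs) (hJ₁G q hq), hKcomm]
  constructor
  · refine main J₁ (α₁ q) m₁ comm₁ fun k l => ?_
    have h := hxz k l
    generalize (A k q)⁻¹ *ᵥ (J₁ q *ᵥ x l) = z at *
    rw [h]
    simp only [add_dotProduct, smul_dotProduct, dotProduct_add, dotProduct_smul, smul_eq_mul]
    ring
  · refine main J₂ (α₂ q) m₂ comm₂ fun k l => ?_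
    have h := hxz k l
    rw [hxz' k l]
    generalize (A k q)⁻¹ *ᵥ (J₁ q *ᵥ x l) = z at *
    rw [h]
    simp only [add_dotProduct, smul_dotProduct, dotProduct_add, dotProduct_sub, dotProduct_smul,
      smul_eq_mul]
    ring
end
end

section
/- Let U ⊆ ℝⁿ be open and let J : U → Mₙ(ℝ) be a smooth (1,1)-tensor field with invertible values whose Nijenhuis torsion vanishes: J^l_i ∂_l J^k_j − J^l_j ∂_l J^k_i − J^k_l(∂_i J^l_j − ∂_j J^l_i) = 0 for all i, j, k. Define Φ : U × ℝⁿ → U × ℝⁿ by Φ(q, p̄) = (q, J(q)ᵀ p̄). Then the pushforward of the canonical Poisson matrix under Φ equals Π_nc(J): for every (q, p̄) ∈ U × ℝⁿ, DΦ(q,p̄) · Π_c · DΦ(q,p̄)ᵀ = Π_nc(J)(Φ(q,p̄)), where DΦ is the Jacobian matrix of Φ and Π_c = [[0, I],[−I, 0]]. -/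
noncomputable section
open Matrix

/-- The noncanonical Poisson matrix `Π_nc(J) = [[0, J],[−Jᵀ, Ω]]` at `(q,p)`. -/
def PiNC {n : ℕ} (J : (Fin n → ℝ) → Matrix (Fin n) (Fin n) ℝ)
    (q p : Fin n → ℝ) : Matrix (Fin n ⊕ Fin n) (Fin n ⊕ Fin n) ℝ :=
  Matrix.fromBlocks 0 (J q) (-(J q)ᵀ) (Matrix.of fun i j => Omega J q p i j)

/-- The canonical Poisson matrix `Π_c = [[0, I],[−I, 0]]`. -/
def PiC (n : ℕ) : Matrix (Fin n ⊕ Fin n) (Fin n ⊕ Fin n) ℝ :=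
  Matrix.fromBlocks 0 1 (-1) 0

/-- The components of the map `Φ(q,p̄) = (q, J(q)ᵀ p̄)` on phase space. -/
def phiComp {n : ℕ} (J : (Fin n → ℝ) → Matrix (Fin n) (Fin n) ℝ) :
    Fin n ⊕ Fin n → (Fin n → ℝ) × (Fin n → ℝ) → ℝ
  | Sum.inl i => fun z => z.1 i
  | Sum.inr i => fun z => ∑ k, J z.1 k i * z.2 k

/-- The standard basis vectors of the phase space `ℝⁿ × ℝⁿ`. -/
def basisVec {n : ℕ} : Fin n ⊕ Fin n → (Fin n → ℝ) × (Fin n → ℝ)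
  | Sum.inl j => (Pi.single j 1, 0)
  | Sum.inr j => (0, Pi.single j 1)

/-- The Jacobian matrix `DΦ` of the map with components `phiComp J`. -/
def jacPhi {n : ℕ} (J : (Fin n → ℝ) → Matrix (Fin n) (Fin n) ℝ)
    (z : (Fin n → ℝ) × (Fin n → ℝ)) : Matrix (Fin n ⊕ Fin n) (Fin n ⊕ Fin n) ℝ :=
  Matrix.of fun a b => fderiv ℝ (phiComp J a) z (basisVec b)

/-- The Jacobian matrix of `Φ(q,p̄) = (q, J(q)ᵀ p̄)` in block form. -/
theorem jacPhi_eq_fromBlocks {n : ℕ} {J : (Fin n → ℝ) → Matrix (Fin n) (Fin n) ℝ}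
    {q : Fin n → ℝ} (hJ : ∀ i j, DifferentiableAt ℝ (fun q' => J q' i j) q)
    (pb : Fin n → ℝ) :
    jacPhi J (q, pb) = Matrix.fromBlocks 1 0
      (Matrix.of fun i j => ∑ k, pd (fun q' => J q' k i) j q * pb k) (J q)ᵀ := by
  have hfst (i : Fin n) : HasFDerivAt (phiComp J (Sum.inl i))
      ((ContinuousLinearMap.proj i).comp
        (ContinuousLinearMap.fst ℝ (Fin n → ℝ) (Fin n → ℝ))) (q, pb) :=
    ((ContinuousLinearMap.proj (R := ℝ) (φ := fun _ : Fin n => ℝ) i).comp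
      (ContinuousLinearMap.fst ℝ (Fin n → ℝ) (Fin n → ℝ))).hasFDerivAt
  have hsnd (k : Fin n) : HasFDerivAt (fun z : (Fin n → ℝ) × (Fin n → ℝ) => z.2 k)
      ((ContinuousLinearMap.proj k).comp
        (ContinuousLinearMap.snd ℝ (Fin n → ℝ) (Fin n → ℝ))) (q, pb) :=
    ((ContinuousLinearMap.proj (R := ℝ) (φ := fun _ : Fin n => ℝ) k).comp
      (ContinuousLinearMap.snd ℝ (Fin n → ℝ) (Fin n → ℝ))).hasFDerivAt
  have hentry (k i : Fin n) :
      HasFDerivAt (fun z : (Fin n → ℝ) × (Fin n → ℝ) => J z.1 k i)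
        ((fderiv ℝ (fun q' => J q' k i) q).comp
          (ContinuousLinearMap.fst ℝ (Fin n → ℝ) (Fin n → ℝ))) (q, pb) :=
    HasFDerivAt.comp (g := fun q' => J q' k i) (q, pb) (hJ k i).hasFDerivAt hasFDerivAt_fst
  have hmom (i : Fin n) : HasFDerivAt (phiComp J (Sum.inr i)) _ (q, pb) :=
    HasFDerivAt.fun_sum (u := Finset.univ) fun k _ => (hentry k i).mul (hsnd k)
  ext (i | i) (j | j)
  · rw [jacPhi, Matrix.of_apply, (hfst i).fderiv]
    simp [basisVec, Matrix.one_apply, Pi.single_apply]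
  · rw [jacPhi, Matrix.of_apply, (hfst i).fderiv]
    simp [basisVec]
  · rw [jacPhi, Matrix.of_apply, (hmom i).fderiv]
    simp [basisVec, pd, mul_comm]
  · rw [jacPhi, Matrix.of_apply, (hmom i).fderiv]
    simp [basisVec, Pi.single_apply]

/-- If `J` is a torsionfree invertible (1,1)-tensor field, the
pushforward of the canonical Poisson matrix under `Φ(q,p̄) = (q, J(q)ᵀp̄)` is
`Π_nc(J)` evaluated at `Φ(q,p̄)`. -/
theorem pushforward_canonical_is_PiNC
    (n : ℕ) (U : Set (Fin n → ℝ)) (hU : IsOpen U)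
    (J : (Fin n → ℝ) → Matrix (Fin n) (Fin n) ℝ)
    (hJsm : ∀ i j, ContDiffOn ℝ (⊤ : ℕ∞) (fun q => J q i j) U)
    (hJns : ∀ q ∈ U, IsUnit (J q).det)
    -- vanishing of the Nijenhuis torsion of J
    (hNij : ∀ q ∈ U, ∀ i j k : Fin n,
      (∑ l, J q l i * pd (fun q' => J q' k j) l q)
        - (∑ l, J q l j * pd (fun q' => J q' k i) l q)
        - (∑ l, J q k l *
            (pd (fun q' => J q' l j) i q - pd (fun q' => J q' l i) j q)) = 0) :
    ∀ q ∈ U, ∀ pb : Fin n → ℝ,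
      jacPhi J (q, pb) * PiC n * (jacPhi J (q, pb))ᵀ
        = PiNC J q ((J q)ᵀ *ᵥ pb) := by
  intro q hq pb
  have hJ (i j : Fin n) : DifferentiableAt ℝ (fun q' => J q' i j) q :=
    ((hJsm i j).contDiffAt (hU.mem_nhds hq)).differentiableAt (by simp)
  rw [jacPhi_eq_fromBlocks hJ, PiC, PiNC, Matrix.fromBlocks_transpose,
    Matrix.fromBlocks_multiply, Matrix.fromBlocks_multiply]
  congr 1
  · simp
  · simp
  · simp
  · ext i j
    have hL : ∑ l, (∑ k, pd (fun q' => J q' k i) l q * pb k) * J q l j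
        = ∑ k, (∑ l, J q l j * pd (fun q' => J q' k i) l q) * pb k := by
      simp_rw [Finset.sum_mul]
      rw [Finset.sum_comm]
      exact Finset.sum_congr rfl fun _ _ => Finset.sum_congr rfl fun _ _ => by ring
    have hR : ∑ l, J q l i * (∑ k, pd (fun q' => J q' k j) l q * pb k)
        = ∑ k, (∑ l, J q l i * pd (fun q' => J q' k j) l q) * pb k := by
      simp_rw [Finset.sum_mul, Finset.mul_sum]
      rw [Finset.sum_comm]
      exact Finset.sum_congr rfl fun _ _ => Finset.sum_congr rfl fun _ _ => by ring
    have hO : Omega J q ((J q)ᵀ *ᵥ pb) i j = ∑ k, -(∑ l, J q k l *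
        (pd (fun q' => J q' l j) i q - pd (fun q' => J q' l i) j q)) * pb k := by
      simp_rw [Omega, Matrix.mulVec, dotProduct, Matrix.transpose_apply,
        ← Finset.sum_neg_distrib, Finset.sum_mul, Finset.mul_sum]
      rw [Finset.sum_comm]
      exact Finset.sum_congr rfl fun _ _ => Finset.sum_congr rfl fun _ _ => by ring
    simp only [Matrix.mul_zero, Matrix.mul_one, Matrix.mul_neg, zero_add, add_zero,
      Matrix.neg_mul, Matrix.add_apply, Matrix.neg_apply, Matrix.mul_apply,
      Matrix.transpose_apply, Matrix.of_apply, Matrix.transpose_transpose]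
    rw [hL, hR, hO, ← Finset.sum_neg_distrib, ← Finset.sum_add_distrib]
    refine Finset.sum_congr rfl fun k _ => ?_
    linear_combination (-pb k) * hNij q hq i j k
end
end

section
/- Let g = diag(ε₁, …, εₙ) with each ε_i = ±1 be a constant flat metric on ℝⁿ (so its Christoffel symbols vanish and covariant derivatives are partial derivatives), let β ∈ ℝⁿ and let γ ∈ Mₙ(ℝ) be a constant symmetric matrix. Define the (1,1)-tensor field J(q) = (βqᵀ + qβᵀ + γ) g, its contravariant form J^{ij}(q) = β^i q^j + β^j q^i + γ^{ij}, and σ(q) = det J(q). At any point q where σ(q) ≠ 0, set σ_i = (1/σ)∂σ/∂q^i. Then the condition J^{ij}(σ_i σ_j + (1/(n+1)) ∂σ_j/∂q^i) = 0 holds at q if and only if βᵀ g (cof J(q)) β = 0. -/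
noncomputable section
open Matrix

theorem pd_eq_of_hasLineDerivAt {n : ℕ} {f : (Fin n → ℝ) → ℝ} {i : Fin n} {q : Fin n → ℝ}
    {d : ℝ} (hf : DifferentiableAt ℝ f q) (h : HasLineDerivAt ℝ f d q (Pi.single i 1)) :
    pd f i q = d := by
  rw [pd, ← hf.lineDeriv_eq_fderiv, h.lineDeriv]

theorem hasLineDerivAt_pd {n : ℕ} {f : (Fin n → ℝ) → ℝ} {q : Fin n → ℝ}
    (hf : DifferentiableAt ℝ f q) (i : Fin n) :
    HasLineDerivAt ℝ f (pd f i q) q (Pi.single i 1) :=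
  hf.hasFDerivAt.hasLineDerivAt _

theorem differentiableAt_matrix_det {E ι : Type*} [NormedAddCommGroup E] [NormedSpace ℝ E]
    [Fintype ι] [DecidableEq ι] {A : E → Matrix ι ι ℝ} {x : E}
    (hA : ∀ i j, DifferentiableAt ℝ (fun y => A y i j) x) :
    DifferentiableAt ℝ (fun y => (A y).det) x := by
  simp only [det_apply']
  fun_prop

theorem differentiableAt_matrix_inv_apply {E ι : Type*} [NormedAddCommGroup E] [NormedSpace ℝ E]
    [Fintype ι] [DecidableEq ι] {A : E → Matrix ι ι ℝ} {x : E}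
    (hA : ∀ i j, DifferentiableAt ℝ (fun y => A y i j) x) (hx : (A x).det ≠ 0) (i j : ι) :
    DifferentiableAt ℝ (fun y => (A y)⁻¹ i j) x := by
  simp only [inv_def, Matrix.smul_apply, Ring.inverse_eq_inv', smul_eq_mul, adjugate_apply]
  refine ((differentiableAt_matrix_det hA).inv hx).mul (differentiableAt_matrix_det fun k l => ?_)
  simp only [updateRow_apply]
  split_ifs
  · fun_prop
  · exact hA k l

/-- Jacobi's formula along an affine line. -/
theorem hasDerivAt_det_add_smul {ι : Type*} [Fintype ι] [DecidableEq ι] (A M : Matrix ι ι ℝ)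
    (hA : A.det ≠ 0) :
    HasDerivAt (fun t : ℝ => (A + t • M).det) (A.det * (A⁻¹ * M).trace) 0 := by
  have hu : IsUnit A.det := hA.isUnit
  have key (t : ℝ) : (A + t • M).det = A.det * (1 + t • (A⁻¹ * M)).det := by
    rw [← det_mul, Matrix.mul_add, Matrix.mul_one, Matrix.mul_smul, ← Matrix.mul_assoc,
      mul_nonsing_inv A hu, Matrix.one_mul]
  simp_rw [key]
  refine HasDerivAt.const_mul _ ?_
  rw [funext fun t : ℝ => det_one_add_smul t (A⁻¹ * M)]
  have h := (((hasDerivAt_id' (0 : ℝ)).const_mul (A⁻¹ * M).trace).const_add 1).fun_add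
    (((det (1 + (Polynomial.X : Polynomial ℝ) • (A⁻¹ * M).map Polynomial.C)).divX.divX.hasDerivAt
      0).fun_mul ((hasDerivAt_id' (0 : ℝ)).fun_pow 2))
  simpa using h

/-- The matrix `βqᵀ + qβᵀ + γ`. -/
def symMat {n : ℕ} (β : Fin n → ℝ) (γ : Matrix (Fin n) (Fin n) ℝ) (q : Fin n → ℝ) :
    Matrix (Fin n) (Fin n) ℝ :=
  vecMulVec β q + vecMulVec q β + γ

theorem symMat_isSymm {n : ℕ} (β : Fin n → ℝ) {γ : Matrix (Fin n) (Fin n) ℝ} (hγ : γ.IsSymm)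
    (q : Fin n → ℝ) : (symMat β γ q).IsSymm := by
  ext i j
  simp only [symMat, transpose_apply, Matrix.add_apply, vecMulVec_apply, hγ.apply i j]
  ring

theorem symMat_add_smul {n : ℕ} (β : Fin n → ℝ) (γ : Matrix (Fin n) (Fin n) ℝ)
    (q v : Fin n → ℝ) (t : ℝ) :
    symMat β γ (q + t • v) = symMat β γ q + t • (vecMulVec β v + vecMulVec v β) := by
  ext i j
  simp only [symMat, Matrix.add_apply, vecMulVec_apply, Matrix.smul_apply, Pi.add_apply, Pi.smul_apply,
    smul_eq_mul]
  ring

theorem differentiable_symMat_apply {n : ℕ} (β : Fin n → ℝ) (γ : Matrix (Fin n) (Fin n) ℝ)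
    (i j : Fin n) : Differentiable ℝ (fun q => symMat β γ q i j) := by
  simp only [symMat, Matrix.add_apply, vecMulVec_apply]
  fun_prop

theorem differentiable_det_symMat {n : ℕ} (β : Fin n → ℝ) (γ : Matrix (Fin n) (Fin n) ℝ) :
    Differentiable ℝ (fun q => (symMat β γ q).det) := fun q =>
  differentiableAt_matrix_det fun i j => differentiable_symMat_apply β γ i j q

theorem pd_det_symMat {n : ℕ} (β : Fin n → ℝ) {γ : Matrix (Fin n) (Fin n) ℝ} (hγ : γ.IsSymm)
    (q : Fin n → ℝ) (hq : (symMat β γ q).det ≠ 0) (j : Fin n) :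
    pd (fun q => (symMat β γ q).det) j q
      = (symMat β γ q).det * (2 * ((symMat β γ q)⁻¹ *ᵥ β) j) := by
  refine pd_eq_of_hasLineDerivAt (differentiable_det_symMat β γ q) ?_
  have h := hasDerivAt_det_add_smul (symMat β γ q)
    (vecMulVec β (Pi.single j 1) + vecMulVec (Pi.single j 1) β) hq
  have hs : (symMat β γ q)⁻¹ᵀ = (symMat β γ q)⁻¹ := by
    rw [transpose_nonsing_inv, symMat_isSymm β hγ q]
  have htr : ((symMat β γ q)⁻¹ *
      (vecMulVec β (Pi.single j 1) + vecMulVec (Pi.single j 1) β)).trace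
      = 2 * ((symMat β γ q)⁻¹ *ᵥ β) j := by
    rw [Matrix.mul_add, trace_add, mul_vecMulVec, mul_vecMulVec, trace_vecMulVec, trace_vecMulVec,
      dotProduct_comm (_ *ᵥ Pi.single j 1), dotProduct_mulVec, ← mulVec_transpose, hs,
      dotProduct_single_one]
    ring
  rw [htr] at h
  simpa only [HasLineDerivAt, symMat_add_smul] using h

theorem pd_symMat_inv_mulVec {n : ℕ} (β : Fin n → ℝ) (γ : Matrix (Fin n) (Fin n) ℝ)
    (q : Fin n → ℝ) (hq : (symMat β γ q).det ≠ 0) (i j : Fin n) :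
    pd (fun q => ((symMat β γ q)⁻¹ *ᵥ β) j) i q
      = -(((symMat β γ q)⁻¹ *ᵥ β) i * ((symMat β γ q)⁻¹ *ᵥ β) j
        + (β ⬝ᵥ ((symMat β γ q)⁻¹ *ᵥ β)) * (symMat β γ q)⁻¹ j i) := by
  set w : (Fin n → ℝ) → Fin n → ℝ := fun q => (symMat β γ q)⁻¹ *ᵥ β with hw
  set e : Fin n → ℝ := Pi.single i 1 with he
  have hwd (k : Fin n) : DifferentiableAt ℝ (fun q => w q k) q := by
    simp only [hw, mulVec, dotProduct]
    exact DifferentiableAt.fun_sum fun l _ => (differentiableAt_matrix_inv_apply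
      (fun a b => differentiable_symMat_apply β γ a b q) hq k l).mul_const _
  have hAw : ∀ᶠ q' in nhds q, symMat β γ q' *ᵥ w q' = β := by
    filter_upwards [(differentiable_det_symMat β γ q).continuousAt.eventually_ne hq] with q' hq'
    simp only [hw, mulVec_mulVec, mul_nonsing_inv _ (Ne.isUnit hq'), one_mulVec]
  have hline : ∀ᶠ t in nhds (0 : ℝ), symMat β γ (q + t • e) *ᵥ w (q + t • e) = β := by
    have hc : ContinuousAt (fun t : ℝ => q + t • e) 0 := by fun_prop
    have hc' : Filter.Tendsto (fun t : ℝ => q + t • e) (nhds 0) (nhds q) := by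
      simpa [ContinuousAt] using hc
    exact hc'.eventually hAw
  have hprod : (vecMulVec β e + vecMulVec e β) *ᵥ w q
      + symMat β γ q *ᵥ (fun k => pd (fun q => w q k) i q) = 0 := by
    ext l
    have h1 : HasDerivAt (fun t : ℝ => ∑ k, symMat β γ (q + t • e) l k * w (q + t • e) k)
        (∑ k, ((vecMulVec β e + vecMulVec e β) l k * w q k
          + symMat β γ q l k * pd (fun q => w q k) i q)) 0 := by
      refine HasDerivAt.fun_sum fun k _ => ?_
      have hA : HasDerivAt (fun t : ℝ => symMat β γ (q + t • e) l k)
          ((vecMulVec β e + vecMulVec e β) l k) 0 := by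
        simp only [symMat_add_smul, Matrix.add_apply _ (_ • _), Matrix.smul_apply, smul_eq_mul]
        simpa only [id, one_mul] using ((hasDerivAt_id (0 : ℝ)).mul_const
          ((vecMulVec β e + vecMulVec e β) l k)).const_add (symMat β γ q l k)
      have hwk : HasDerivAt (fun t : ℝ => w (q + t • e) k) (pd (fun q => w q k) i q) 0 :=
        hasLineDerivAt_pd (hwd k) i
      simpa only [zero_smul, add_zero] using hA.fun_mul hwk
    have h2 : HasDerivAt (fun t : ℝ => ∑ k, symMat β γ (q + t • e) l k * w (q + t • e) k) 0 0 :=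
      (hasDerivAt_const (0 : ℝ) (β l)).congr_of_eventuallyEq
        (hline.mono fun t ht => congrFun ht l)
    simpa [mulVec, dotProduct, Finset.sum_add_distrib] using h1.unique h2
  have hsolve : (fun k => pd (fun q => w q k) i q)
      = -((symMat β γ q)⁻¹ *ᵥ ((vecMulVec β e + vecMulVec e β) *ᵥ w q)) := by
    rw [eq_neg_of_add_eq_zero_left hprod, mulVec_neg, neg_neg, mulVec_mulVec,
      nonsing_inv_mul _ hq.isUnit, one_mulVec]
  refine (congrFun hsolve j).trans ?_
  rw [add_mulVec, vecMulVec_mulVec, vecMulVec_mulVec, mulVec_add]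
  simp [he, mulVec_smul, hw]

/-- The left-hand side of the flatness condition equals `2 βᵀ A⁻¹ β`. -/
theorem flatness_sum_eq {n : ℕ} (A : Matrix (Fin n) (Fin n) ℝ) (hA : A.det ≠ 0)
    (β : Fin n → ℝ) :
    ∑ i, ∑ j, A i j * ((2 * (A⁻¹ *ᵥ β) i) * (2 * (A⁻¹ *ᵥ β) j)
      + (1 / ((n : ℝ) + 1)) * (2 * -((A⁻¹ *ᵥ β) i * (A⁻¹ *ᵥ β) j
        + (β ⬝ᵥ (A⁻¹ *ᵥ β)) * A⁻¹ j i))) = 2 * (β ⬝ᵥ (A⁻¹ *ᵥ β)) := by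
  set w := A⁻¹ *ᵥ β with hw
  have h1 : ∑ i, ∑ j, A i j * (w i * w j) = β ⬝ᵥ w := by
    have : A *ᵥ w = β := by rw [hw, mulVec_mulVec, mul_nonsing_inv _ hA.isUnit, one_mulVec]
    calc _ = w ⬝ᵥ (A *ᵥ w) := by
          simp only [dotProduct, mulVec, Finset.mul_sum]
          exact Finset.sum_congr rfl fun i _ => Finset.sum_congr rfl fun j _ => by ring
      _ = _ := by rw [this, dotProduct_comm]
  have h2 : ∑ i, ∑ j, A i j * A⁻¹ j i = n := by
    have := congrArg trace (mul_nonsing_inv A hA.isUnit)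
    simpa [trace, mul_apply] using this
  have hn : (n : ℝ) + 1 ≠ 0 := by positivity
  calc _ = (4 - 2 / ((n : ℝ) + 1)) * ∑ i, ∑ j, A i j * (w i * w j)
        - 2 / ((n : ℝ) + 1) * (β ⬝ᵥ w) * ∑ i, ∑ j, A i j * A⁻¹ j i := by
        simp only [Finset.mul_sum, ← Finset.sum_sub_distrib]
        exact Finset.sum_congr rfl fun i _ => Finset.sum_congr rfl fun j _ => by ring
    _ = _ := by rw [h1, h2]; field_simp; ring

/-- For a flat diagonal metric `g = diag(ε)` and the J-tensor
`J(q) = (βqᵀ + qβᵀ + γ)g`, at every point where `σ = det J ≠ 0` the flatness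
condition `J^{ij}(σ_iσ_j + (1/(n+1))∂_iσ_j) = 0` holds iff `βᵀ g (cof J) β = 0`. -/
theorem flat_deformation_condition_iff
    (n : ℕ) (ε : Fin n → ℝ) (hε : ∀ i, ε i = 1 ∨ ε i = -1)
    (g : Matrix (Fin n) (Fin n) ℝ) (hg : g = Matrix.diagonal ε)
    (β : Fin n → ℝ) (γ : Matrix (Fin n) (Fin n) ℝ) (hγ : γ.IsSymm)
    (J : (Fin n → ℝ) → Matrix (Fin n) (Fin n) ℝ)
    (hJ : J = fun q => (vecMulVec β q + vecMulVec q β + γ) * g)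
    (Jc : (Fin n → ℝ) → Matrix (Fin n) (Fin n) ℝ)
    (hJc : ∀ q i j, Jc q i j = β i * q j + β j * q i + γ i j)
    (σ : (Fin n → ℝ) → ℝ) (hσ : σ = fun q => (J q).det)
    (q : Fin n → ℝ) (hq : σ q ≠ 0) :
    (∑ i, ∑ j, Jc q i j *
        (((1 / σ q) * pd σ i q) * ((1 / σ q) * pd σ j q)
          + (1 / ((n : ℝ) + 1)) * pd (fun q' => (1 / σ q') * pd σ j q') i q) = 0)
    ↔ β ⬝ᵥ ((g * (J q).adjugate) *ᵥ β) = 0 := by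
  have hJ' (p : Fin n → ℝ) : J p = symMat β γ p * g := by rw [hJ, symMat]
  have hJc' : Jc q = symMat β γ q := by
    ext i j
    simp only [hJc, symMat, Matrix.add_apply, vecMulVec_apply]
    ring
  have hσ' : σ = fun p => g.det * (symMat β γ p).det := by
    rw [hσ]
    ext p
    rw [hJ', det_mul, mul_comm]
  have hgdet : g.det ≠ 0 := by
    rw [hg, det_diagonal]
    exact Finset.prod_ne_zero_iff.mpr fun i _ => by rcases hε i with h | h <;> norm_num [h]
  have hA : (symMat β γ q).det ≠ 0 := fun h => hq (by rw [hσ']; simp [h])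
  have hlog (j : Fin n) (p : Fin n → ℝ) (hp : (symMat β γ p).det ≠ 0) :
      (1 / σ p) * pd σ j p = 2 * ((symMat β γ p)⁻¹ *ᵥ β) j := by
    have hpd : pd σ j p = g.det * pd (fun p => (symMat β γ p).det) j p := by
      rw [hσ', pd, fderiv_const_mul (differentiable_det_symMat β γ p)]
      rfl
    rw [hpd, pd_det_symMat β hγ p hp, hσ']
    field_simp
  have hlog' (i j : Fin n) : pd (fun p => (1 / σ p) * pd σ j p) i q
      = 2 * -(((symMat β γ q)⁻¹ *ᵥ β) i * ((symMat β γ q)⁻¹ *ᵥ β) j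
        + (β ⬝ᵥ ((symMat β γ q)⁻¹ *ᵥ β)) * (symMat β γ q)⁻¹ j i) := by
    have hev : (fun p => (1 / σ p) * pd σ j p)
        =ᶠ[nhds q] (2 : ℝ) • fun p => ((symMat β γ p)⁻¹ *ᵥ β) j := by
      filter_upwards [(differentiable_det_symMat β γ q).continuousAt.eventually_ne hA] with p hp
      exact hlog j p hp
    rw [← pd_symMat_inv_mulVec β γ q hA i j, pd, hev.fderiv_eq, pd, fderiv_const_smul_field]
    rfl
  simp only [hlog _ q hA, hlog', hJc', flatness_sum_eq _ hA β]
  have hadj : g * (J q).adjugate = (g.det * (symMat β γ q).det) • (symMat β γ q)⁻¹ := by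
    rw [hJ', adjugate_mul_distrib, ← Matrix.mul_assoc, mul_adjugate, smul_mul, Matrix.one_mul,
      inv_def, Ring.inverse_eq_inv', smul_smul, mul_assoc, mul_inv_cancel₀ hA, mul_one]
  rw [hadj, smul_mulVec, dotProduct_smul, smul_eq_mul]
  simp [hgdet, hA]
end
end

section
/- Let g = diag(ε₁, …, εₙ) with each ε_i = ±1 be a constant matrix, let β ∈ ℝⁿ, let γ ∈ Mₙ(ℝ) be constant symmetric, and define J(q) = (βqᵀ + qβᵀ + γ) g and σ(q) = det J(q). Then for every q ∈ ℝⁿ the gradient of σ satisfies dσ = 2 g (cof J) β, i.e. ∂σ/∂q^i = 2 (g · cof J(q) · β)_i for i = 1, …, n. -/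
noncomputable section
open Matrix

/-- **Jacobi's formula** for the Fréchet derivative of a determinant. -/
theorem HasFDerivAt.matrix_det {E m : Type*} [NormedAddCommGroup E] [NormedSpace ℝ E]
    [Fintype m] [DecidableEq m] {M : E → m → m → ℝ} {M' : E →L[ℝ] m → m → ℝ} {x : E}
    (hM : HasFDerivAt M M' x) :
    ∃ D : E →L[ℝ] ℝ, HasFDerivAt (fun y => (of (M y)).det) D x ∧
      ∀ v, D v = ((of (M x)).adjugate * of (M' v)).trace := by
  let det' : ContinuousMultilinearMap ℝ (fun _ : m => m → ℝ) ℝ :=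
    { (detRowAlternating : (m → ℝ) [⋀^m]→ₗ[ℝ] ℝ).toMultilinearMap with
      cont := Continuous.matrix_det (A := fun M : m → m → ℝ => of M) continuous_id }
  refine ⟨_, (det'.hasFDerivAt (M x)).comp x hM, fun v => ?_⟩
  have hrow : ∀ i, ((of (M x)).updateRow i (M' v i)).det =
      ∑ j, (of (M x)).adjugate j i * M' v i j := fun i => by
    rw [← cramer_transpose_apply, cramer_eq_adjugate_mulVec, ← adjugate_transpose]
    rfl
  rw [ContinuousLinearMap.comp_apply, ContinuousMultilinearMap.linearDeriv_apply]
  refine (Finset.sum_congr rfl fun i _ => hrow i).trans ?_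
  rw [Finset.sum_comm]
  rfl

/-- Against a symmetric matrix, both rank-one terms of `u vᵀ + v uᵀ` have the same trace. -/
theorem Matrix.IsSymm.trace_mul_vecMulVec_add_vecMulVec {m R : Type*} [Fintype m] [CommRing R]
    {A : Matrix m m R} (hA : A.IsSymm) (u v : m → R) :
    (A * (vecMulVec u v + vecMulVec v u)).trace = 2 * ((A *ᵥ u) ⬝ᵥ v) := by
  have hswap : (A *ᵥ v) ⬝ᵥ u = (A *ᵥ u) ⬝ᵥ v := by
    rw [dotProduct_comm, dotProduct_mulVec, ← mulVec_transpose, hA.eq]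
  rw [mul_add, trace_add, mul_vecMulVec, mul_vecMulVec, trace_vecMulVec, trace_vecMulVec,
    hswap, two_mul]

/-- The linear map `q ↦ β qᵀ + q βᵀ`. -/
def symVecMulVec {m : Type*} (β : m → ℝ) : (m → ℝ) →ₗ[ℝ] m → m → ℝ where
  toFun q := vecMulVec β q + vecMulVec q β
  map_add' p q := by
    rw [vecMulVec_add, add_vecMulVec]
    exact add_add_add_comm _ _ _ _
  map_smul' c q := by
    rw [vecMulVec_smul, smul_vecMulVec]
    exact (smul_add c _ _).symm

/-- For `g = diag(ε)` constant and `J(q) = (βqᵀ + qβᵀ + γ)g`,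
the gradient of `σ = det J` satisfies `dσ = 2 g (cof J) β`. -/
theorem gradient_of_det_J
    (n : ℕ) (ε : Fin n → ℝ) (hε : ∀ i, ε i = 1 ∨ ε i = -1)
    (g : Matrix (Fin n) (Fin n) ℝ) (hg : g = Matrix.diagonal ε)
    (β : Fin n → ℝ) (γ : Matrix (Fin n) (Fin n) ℝ) (hγ : γ.IsSymm)
    (J : (Fin n → ℝ) → Matrix (Fin n) (Fin n) ℝ)
    (hJ : J = fun q => (vecMulVec β q + vecMulVec q β + γ) * g)
    (σ : (Fin n → ℝ) → ℝ) (hσ : σ = fun q => (J q).det) :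
    ∀ q : Fin n → ℝ, ∀ i,
      pd σ i q = 2 * ((g * (J q).adjugate) *ᵥ β) i := by
  subst hg hJ hσ
  intro q i
  set S : Matrix (Fin n) (Fin n) ℝ := vecMulVec β q + vecMulVec q β + γ with hS
  have hSsymm : S.IsSymm := by
    rw [IsSymm, hS, transpose_add, transpose_add, transpose_vecMulVec, transpose_vecMulVec,
      hγ.eq, add_comm (vecMulVec q β)]
  have hadj : S.adjugate.IsSymm := by rw [IsSymm, adjugate_transpose, hSsymm.eq]
  obtain ⟨D, hD, hDv⟩ :=
    ((symVecMulVec β).toContinuousLinearMap.hasFDerivAt (x := q)).add_const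
      (of.symm γ) |>.matrix_det
  have hσ : HasFDerivAt
      (fun p => ((vecMulVec β p + vecMulVec p β + γ) * diagonal ε).det)
      ((diagonal ε).det • D) q := by
    simp_rw [det_mul]
    exact hD.mul_const _
  have htrace : D (Pi.single i 1) = 2 * (S.adjugate *ᵥ β) i := by
    rw [hDv]
    refine (hadj.trace_mul_vecMulVec_add_vecMulVec β (Pi.single i 1)).trans ?_
    rw [dotProduct_single_one]
  rw [pd, hσ.fderiv]
  change (diagonal ε).det * D (Pi.single i 1) =
    2 * ((diagonal ε * (S * diagonal ε).adjugate) *ᵥ β) i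
  rw [htrace, adjugate_mul_distrib, ← Matrix.mul_assoc, mul_adjugate, Matrix.smul_mul, Matrix.one_mul,
    smul_mulVec, Pi.smul_apply, smul_eq_mul, mul_left_comm]
end
end

section
/- Let g = diag(ε₁, …, εₙ) with each ε_i = ±1 be a constant matrix, let β ∈ ℝⁿ, let γ ∈ Mₙ(ℝ) be constant symmetric, define J(q) = (βqᵀ + qβᵀ + γ) g, its contravariant form J^{ij}(q) = β^i q^j + β^j q^i + γ^{ij}, and σ(q) = det J(q). Then for every q ∈ ℝⁿ, the contraction of J with the Hessian of σ satisfies J^{ij}(q) · ∂²σ/∂q^i∂q^j (q) = 2(1 − n) βᵀ g (cof J(q)) β. -/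
noncomputable section
open Matrix

section Determinant

variable {ι E : Type*} [Fintype ι] [DecidableEq ι] [NormedAddCommGroup E] [NormedSpace ℝ E]

/-- Jacobi's formula for the derivative of a determinant. -/
theorem hasFDerivAt_matrix_det {A : E → Matrix ι ι ℝ} {A' : ι → ι → E →L[ℝ] ℝ} {x : E}
    (hA : ∀ i j, HasFDerivAt (fun y => A y i j) (A' i j) x) :
    HasFDerivAt (fun y => (A y).det) (∑ i, ∑ j, (A x).adjugate j i • A' i j) x := by
  let D : ContinuousMultilinearMap ℝ (fun _ : ι => ι → ℝ) ℝ :=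
    { (detRowAlternating : (ι → ℝ) [⋀^ι]→ₗ[ℝ] ℝ).toMultilinearMap with
      cont := Continuous.matrix_det (A := fun M : Matrix ι ι ℝ => M) continuous_id }
  have h := HasFDerivAt.multilinear_comp D (g := fun i y => A y i)
    (g' := fun i => ContinuousLinearMap.pi (A' i)) (x := x)
    fun i => hasFDerivAt_pi.2 fun j => hA i j
  refine h.congr_fderiv ?_
  ext v
  simp only [FunLike.coe_sum, Finset.sum_apply, ContinuousLinearMap.comp_apply]
  refine Finset.sum_congr rfl fun i _ => ?_
  change ((A x).updateRow i fun j => A' i j v).det = _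
  rw [← cramer_transpose_apply, cramer_eq_adjugate_mulVec, ← adjugate_transpose]
  rfl

theorem differentiable_matrix_det {A : E → Matrix ι ι ℝ}
    (hA : ∀ i j, Differentiable ℝ fun y => A y i j) : Differentiable ℝ fun y => (A y).det :=
  fun x => (hasFDerivAt_matrix_det fun i j => (hA i j x).hasFDerivAt).differentiableAt

theorem differentiable_matrix_adjugate_apply {A : E → Matrix ι ι ℝ}
    (hA : ∀ i j, Differentiable ℝ fun y => A y i j) (k l : ι) :
    Differentiable ℝ fun y => (A y).adjugate k l := by
  simp only [adjugate_apply]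
  refine differentiable_matrix_det fun i j => ?_
  by_cases h : i = l
  · simp [updateRow_apply, h]
  · simpa [updateRow_apply, h] using hA i j

end Determinant

section Pencil

variable {n : ℕ} (β : Fin n → ℝ) (γ : Matrix (Fin n) (Fin n) ℝ)

/-- The matrix `βqᵀ + qβᵀ + γ`. -/
def pencil (q : Fin n → ℝ) : Matrix (Fin n) (Fin n) ℝ :=
  vecMulVec β q + vecMulVec q β + γ

theorem pencil_apply (q : Fin n → ℝ) (i j : Fin n) :
    pencil β γ q i j = β i * q j + β j * q i + γ i j := by
  simp [pencil, vecMulVec_apply, mul_comm (q i)]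

theorem hasFDerivAt_pencil_apply (q : Fin n → ℝ) (i j : Fin n) :
    HasFDerivAt (fun q => pencil β γ q i j)
      (β i • ContinuousLinearMap.proj (R := ℝ) j + β j • ContinuousLinearMap.proj (R := ℝ) i) q := by
  simp only [pencil_apply]
  exact (((hasFDerivAt_apply j q).const_mul (β i)).add
    ((hasFDerivAt_apply i q).const_mul (β j))).add_const _

theorem differentiable_pencil_apply (i j : Fin n) :
    Differentiable ℝ fun q => pencil β γ q i j :=
  fun q => (hasFDerivAt_pencil_apply β γ q i j).differentiableAt

theorem pd_pencil_apply (q : Fin n → ℝ) (i j k : Fin n) :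
    pd (fun q => pencil β γ q i j) k q =
      β i * Pi.single (M := fun _ => ℝ) k 1 j + β j * Pi.single (M := fun _ => ℝ) k 1 i := by
  simp [pd, (hasFDerivAt_pencil_apply β γ q i j).fderiv]

variable {γ}

theorem pencil_isSymm (hγ : γ.IsSymm) (q : Fin n → ℝ) : (pencil β γ q).IsSymm := by
  ext i j
  rw [transpose_apply, pencil_apply, pencil_apply, hγ.apply i j]
  ring

theorem pd_det_pencil (hγ : γ.IsSymm) (q : Fin n → ℝ) (k : Fin n) :
    pd (fun q => (pencil β γ q).det) k q = 2 * ((pencil β γ q).adjugate *ᵥ β) k := by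
  have hs : ∀ i j, (pencil β γ q).adjugate i j = (pencil β γ q).adjugate j i :=
    fun i j => (pencil_isSymm β hγ q).adjugate.apply j i
  rw [pd, (hasFDerivAt_matrix_det (hasFDerivAt_pencil_apply β γ q)).fderiv]
  simp only [FunLike.coe_sum, Finset.sum_apply, FunLike.coe_smul, FunLike.coe_add, Pi.smul_apply,
    Pi.add_apply, ContinuousLinearMap.proj_apply, smul_eq_mul, Pi.single_apply, mul_add,
    Finset.sum_add_distrib, mul_ite, mul_one, mul_zero, Finset.sum_ite_eq', Finset.mem_univ,
    if_true, mulVec, dotProduct]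
  rw [Finset.sum_comm (f := fun i j => if i = k then _ else _)]
  simp only [Finset.sum_ite_eq', Finset.mem_univ, if_true, hs _ k, two_mul]

theorem differentiable_adjugate_pencil_mulVec (j : Fin n) :
    Differentiable ℝ fun q => ((pencil β γ q).adjugate *ᵥ β) j := by
  simp only [mulVec, dotProduct]
  exact Differentiable.fun_sum fun l _ =>
    (differentiable_matrix_adjugate_apply (differentiable_pencil_apply β γ) j l).mul_const _

/-- Obtained by differentiating `P (adj P) β = (det P) β`, where `P = βqᵀ + qβᵀ + γ`. -/
theorem sum_pencil_mul_pd_adjugate_mulVec (hγ : γ.IsSymm) (q : Fin n → ℝ) :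
    ∑ i, ∑ j, pencil β γ q i j * pd (fun q => ((pencil β γ q).adjugate *ᵥ β) j) i q =
      (1 - (n : ℝ)) * (β ⬝ᵥ ((pencil β γ q).adjugate *ᵥ β)) := by
  let w : (Fin n → ℝ) → Fin n → ℝ := fun q => (pencil β γ q).adjugate *ᵥ β
  have hwd : ∀ j, Differentiable ℝ fun q => w q j := differentiable_adjugate_pencil_mulVec β
  have hPw : ∀ i, (fun q => ∑ j, pencil β γ q i j * w q j) =
      fun q => (pencil β γ q).det * β i := fun i => by
    funext q
    change (pencil β γ q *ᵥ ((pencil β γ q).adjugate *ᵥ β)) i = _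
    simp [mulVec_mulVec, mul_adjugate, smul_mulVec]
  have key : ∀ i, ∑ j, pencil β γ q i j * pd (fun q => w q j) i q =
      β i * w q i - β ⬝ᵥ w q := fun i => by
    have hL : pd (fun q => ∑ j, pencil β γ q i j * w q j) i q =
        ∑ j, (pencil β γ q i j * pd (fun q => w q j) i q +
          w q j * pd (fun q => pencil β γ q i j) i q) := by
      rw [pd, fderiv_fun_sum fun j _ => ((differentiable_pencil_apply β γ i j) q).fun_mul (hwd j q)]
      simp only [FunLike.coe_sum, Finset.sum_apply]
      refine Finset.sum_congr rfl fun j _ => ?_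
      rw [fderiv_fun_mul (differentiable_pencil_apply β γ i j q) (hwd j q)]
      simp [pd]
    have hR : pd (fun q => (pencil β γ q).det * β i) i q = 2 * w q i * β i := by
      rw [← pd_det_pencil β hγ, pd, fderiv_mul_const
        (differentiable_matrix_det (differentiable_pencil_apply β γ) q)]
      simp [pd, mul_comm]
    rw [hPw i, hR] at hL
    simp only [pd_pencil_apply, Pi.single_apply, if_true, mul_add, mul_ite, mul_one, mul_zero,
      Finset.sum_add_distrib, Finset.sum_ite_eq', Finset.mem_univ] at hL
    simp only [dotProduct, mul_comm (β _)] at hL ⊢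
    linarith
  rw [Finset.sum_congr rfl fun i _ => key i]
  simp only [Finset.sum_sub_distrib, Finset.sum_const, Finset.card_univ, Fintype.card_fin,
    nsmul_eq_mul]
  simp only [dotProduct]
  ring

end Pencil

/-- For `g = diag(ε)` constant and `J(q) = (βqᵀ + qβᵀ + γ)g`
with contravariant form `J^{ij} = β^i q^j + β^j q^i + γ^{ij}` and `σ = det J`,
one has `J^{ij} ∂²σ/∂q^i∂q^j = 2(1 − n) βᵀ g (cof J) β`. -/
theorem J_contract_hessian_of_det
    (n : ℕ) (ε : Fin n → ℝ) (hε : ∀ i, ε i = 1 ∨ ε i = -1)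
    (g : Matrix (Fin n) (Fin n) ℝ) (hg : g = Matrix.diagonal ε)
    (β : Fin n → ℝ) (γ : Matrix (Fin n) (Fin n) ℝ) (hγ : γ.IsSymm)
    (J : (Fin n → ℝ) → Matrix (Fin n) (Fin n) ℝ)
    (hJ : J = fun q => (vecMulVec β q + vecMulVec q β + γ) * g)
    (Jc : (Fin n → ℝ) → Matrix (Fin n) (Fin n) ℝ)
    (hJc : ∀ q i j, Jc q i j = β i * q j + β j * q i + γ i j)
    (σ : (Fin n → ℝ) → ℝ) (hσ : σ = fun q => (J q).det) :
    ∀ q : Fin n → ℝ,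
      ∑ i, ∑ j, Jc q i j * pd (fun q' => pd σ j q') i q
        = 2 * (1 - (n : ℝ)) * (β ⬝ᵥ ((g * (J q).adjugate) *ᵥ β)) := by
  intro q
  have hJP : J = fun q => pencil β γ q * g := hJ
  have hg_adj : g * (J q).adjugate = g.det • (pencil β γ q).adjugate := by
    simp only [hJP]
    rw [adjugate_mul_distrib, ← mul_assoc, mul_adjugate, smul_mul, one_mul]
  have hpd : ∀ j, (fun q => pd σ j q) =
      fun q => 2 * g.det * ((pencil β γ q).adjugate *ᵥ β) j := fun j => by
    funext q
    have hσP : σ = fun q => (pencil β γ q).det * g.det := by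
      simp only [hσ, hJP, det_mul]
    have h := pd_det_pencil β hγ q j
    rw [pd] at h
    rw [hσP, pd, fderiv_mul_const
      (differentiable_matrix_det (differentiable_pencil_apply β γ) q), FunLike.coe_smul,
      Pi.smul_apply, h, smul_eq_mul]
    ring
  have hhess : ∀ i j, pd (fun q => pd σ j q) i q =
      2 * g.det * pd (fun q => ((pencil β γ q).adjugate *ᵥ β) j) i q := fun i j => by
    rw [hpd, pd, fderiv_const_mul (differentiable_adjugate_pencil_mulVec β j q)]
    rfl
  have hJcP : ∀ i j, Jc q i j = pencil β γ q i j := fun i j => by rw [hJc, pencil_apply]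
  simp only [hJcP, hhess, mul_left_comm _ (2 * g.det), ← Finset.mul_sum]
  rw [sum_pencil_mul_pd_adjugate_mulVec β hγ, hg_adj, smul_mulVec, dotProduct_smul, smul_eq_mul]
  ring
end
end

section
/- Let γ ∈ Mₙ(ℝ) be symmetric and let β, q ∈ ℝⁿ. Then βᵀ · cof(βqᵀ + qβᵀ + γ) · β = βᵀ · cof(γ) · β. In particular, the condition βᵀ cof(βqᵀ + qβᵀ + γ) β = 0 is independent of q and equivalent to βᵀ (cof γ) β = 0. -/
noncomputable section
open Matrix

/-- Adding a rank-one matrix with column space spanned by `v` does not change the action of the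
adjugate on `v`. -/
theorem adjugate_add_vecMulVec_mulVec {m R : Type*} [Fintype m] [DecidableEq m] [CommRing R]
    (M : Matrix m m R) (v w : m → R) :
    (M + vecMulVec v w).adjugate *ᵥ v = M.adjugate *ᵥ v := by
  ext i
  rw [← cramer_eq_adjugate_mulVec, ← cramer_eq_adjugate_mulVec, cramer_apply, cramer_apply,
    ← det_transpose, ← det_transpose (M.updateCol i v)]
  refine det_eq_of_forall_row_eq_smul_add_const (Function.update w i 0) i (by simp) fun k j => ?_
  obtain rfl | hk := eq_or_ne k i
  · simp
  · simp [hk, vecMulVec_apply, mul_comm]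

/-- Adding a rank-one matrix with row space spanned by `v` does not change the action of the
adjugate on the row vector `v`. -/
theorem vecMul_adjugate_add_vecMulVec {m R : Type*} [Fintype m] [DecidableEq m] [CommRing R]
    (M : Matrix m m R) (v w : m → R) :
    v ᵥ* (M + vecMulVec w v).adjugate = v ᵥ* M.adjugate := by
  rw [← mulVec_transpose, ← mulVec_transpose, adjugate_transpose, adjugate_transpose,
    transpose_add, transpose_vecMulVec, adjugate_add_vecMulVec_mulVec]

/-- For symmetric `γ` and any `β, q ∈ ℝⁿ`,
`βᵀ cof(βqᵀ + qβᵀ + γ) β = βᵀ (cof γ) β`; in particular the vanishing of the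
left-hand side is independent of `q` and equivalent to `βᵀ (cof γ) β = 0`. -/
theorem beta_cofactor_invariance
    (n : ℕ) (γ : Matrix (Fin n) (Fin n) ℝ) (hγ : γ.IsSymm)
    (β q : Fin n → ℝ) :
    β ⬝ᵥ ((vecMulVec β q + vecMulVec q β + γ).adjugate *ᵥ β)
      = β ⬝ᵥ (γ.adjugate *ᵥ β)
    ∧
    (β ⬝ᵥ ((vecMulVec β q + vecMulVec q β + γ).adjugate *ᵥ β) = 0
      ↔ β ⬝ᵥ (γ.adjugate *ᵥ β) = 0) := by
  have h : β ⬝ᵥ ((vecMulVec β q + vecMulVec q β + γ).adjugate *ᵥ β)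
      = β ⬝ᵥ (γ.adjugate *ᵥ β) := by
    rw [add_assoc, add_comm, adjugate_add_vecMulVec_mulVec, add_comm, dotProduct_mulVec,
      vecMul_adjugate_add_vecMulVec, ← dotProduct_mulVec]
  exact ⟨h, by rw [h]⟩
end
end

section
/- On ℝ⁴ with canonical coordinates (q¹, q², p₁, p₂), the two Hénon–Heiles integrals H̄₁(q,p) = (1/2)p₁² + (1/2)p₂² + (q¹)³ + (1/2)q¹(q²)² and H̄₂(q,p) = (1/2)q²p₁p₂ − (1/2)q¹p₂² + (1/4)(q¹q²)² + (1/16)(q²)⁴ are in involution with respect to the canonical Poisson bracket: {H̄₁, H̄₂} = Σ_{i=1}^{2} (∂H̄₁/∂q^i · ∂H̄₂/∂p_i − ∂H̄₁/∂p_i · ∂H̄₂/∂q^i) = 0 identically on ℝ⁴. In particular H̄₂ is a constant of motion of the canonical Hamiltonian flow of H̄₁. -/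
noncomputable section

/-- The derivative of a real polynomial function of degree at most four. -/
theorem deriv_eq_of_eq_quartic {f : ℝ → ℝ} (a b c d e : ℝ)
    (hf : ∀ x, f x = a + b * x + c * x ^ 2 + d * x ^ 3 + e * x ^ 4) (x : ℝ) :
    deriv f x = b + 2 * c * x + 3 * d * x ^ 2 + 4 * e * x ^ 3 := by
  rw [funext hf]
  have h := (((((hasDerivAt_id x).const_mul b).const_add a).add
    ((hasDerivAt_pow 2 x).const_mul c)).add ((hasDerivAt_pow 3 x).const_mul d)).add
    ((hasDerivAt_pow 4 x).const_mul e)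
  refine (h.congr_deriv ?_).deriv
  push_cast
  ring

/-- The two Hénon–Heiles integrals are in involution with
respect to the canonical Poisson bracket on `ℝ⁴`, so `H̄₂` is a constant of
motion of the canonical Hamiltonian flow of `H̄₁`. -/
theorem henonHeiles_involution
    (H1 H2 : ℝ → ℝ → ℝ → ℝ → ℝ)
    (hH1 : H1 = fun q1 q2 p1 p2 =>
      (1 / 2) * p1 ^ 2 + (1 / 2) * p2 ^ 2 + q1 ^ 3 + (1 / 2) * q1 * q2 ^ 2)
    (hH2 : H2 = fun q1 q2 p1 p2 =>
      (1 / 2) * q2 * p1 * p2 - (1 / 2) * q1 * p2 ^ 2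
        + (1 / 4) * (q1 * q2) ^ 2 + (1 / 16) * q2 ^ 4) :
    ∀ q1 q2 p1 p2 : ℝ,
      deriv (fun x => H1 x q2 p1 p2) q1 * deriv (fun x => H2 q1 q2 x p2) p1
        + deriv (fun x => H1 q1 x p1 p2) q2 * deriv (fun x => H2 q1 q2 p1 x) p2
        - deriv (fun x => H1 q1 q2 x p2) p1 * deriv (fun x => H2 x q2 p1 p2) q1
        - deriv (fun x => H1 q1 q2 p1 x) p2 * deriv (fun x => H2 q1 x p1 p2) q2
      = 0 := by
  subst hH1 hH2
  intro q1 q2 p1 p2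
  rw [deriv_eq_of_eq_quartic ((1 / 2) * p1 ^ 2 + (1 / 2) * p2 ^ 2) ((1 / 2) * q2 ^ 2) 0 1 0
      (f := fun x => (1 / 2) * p1 ^ 2 + (1 / 2) * p2 ^ 2 + x ^ 3 + (1 / 2) * x * q2 ^ 2)
      (fun x => by ring),
    deriv_eq_of_eq_quartic ((1 / 2) * p1 ^ 2 + (1 / 2) * p2 ^ 2 + q1 ^ 3) 0 ((1 / 2) * q1) 0 0
      (f := fun x => (1 / 2) * p1 ^ 2 + (1 / 2) * p2 ^ 2 + q1 ^ 3 + (1 / 2) * q1 * x ^ 2)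
      (fun x => by ring),
    deriv_eq_of_eq_quartic ((1 / 2) * p2 ^ 2 + q1 ^ 3 + (1 / 2) * q1 * q2 ^ 2) 0 (1 / 2) 0 0
      (f := fun x => (1 / 2) * x ^ 2 + (1 / 2) * p2 ^ 2 + q1 ^ 3 + (1 / 2) * q1 * q2 ^ 2)
      (fun x => by ring),
    deriv_eq_of_eq_quartic ((1 / 2) * p1 ^ 2 + q1 ^ 3 + (1 / 2) * q1 * q2 ^ 2) 0 (1 / 2) 0 0
      (f := fun x => (1 / 2) * p1 ^ 2 + (1 / 2) * x ^ 2 + q1 ^ 3 + (1 / 2) * q1 * q2 ^ 2)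
      (fun x => by ring),
    deriv_eq_of_eq_quartic ((1 / 2) * q2 * p1 * p2 + (1 / 16) * q2 ^ 4)
      (-(1 / 2) * p2 ^ 2) ((1 / 4) * q2 ^ 2) 0 0
      (f := fun x => (1 / 2) * q2 * p1 * p2 - (1 / 2) * x * p2 ^ 2
        + (1 / 4) * (x * q2) ^ 2 + (1 / 16) * q2 ^ 4)
      (fun x => by ring),
    deriv_eq_of_eq_quartic (-(1 / 2) * q1 * p2 ^ 2) ((1 / 2) * p1 * p2) ((1 / 4) * q1 ^ 2) 0 (1 / 16)
      (f := fun x => (1 / 2) * x * p1 * p2 - (1 / 2) * q1 * p2 ^ 2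
        + (1 / 4) * (q1 * x) ^ 2 + (1 / 16) * x ^ 4)
      (fun x => by ring),
    deriv_eq_of_eq_quartic
      (-(1 / 2) * q1 * p2 ^ 2 + (1 / 4) * (q1 * q2) ^ 2 + (1 / 16) * q2 ^ 4) ((1 / 2) * q2 * p2) 0 0 0
      (f := fun x => (1 / 2) * q2 * x * p2 - (1 / 2) * q1 * p2 ^ 2
        + (1 / 4) * (q1 * q2) ^ 2 + (1 / 16) * q2 ^ 4)
      (fun x => by ring),
    deriv_eq_of_eq_quartic ((1 / 4) * (q1 * q2) ^ 2 + (1 / 16) * q2 ^ 4) ((1 / 2) * q2 * p1)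
      (-(1 / 2) * q1) 0 0
      (f := fun x => (1 / 2) * q2 * p1 * x - (1 / 2) * q1 * x ^ 2
        + (1 / 4) * (q1 * q2) ^ 2 + (1 / 16) * q2 ^ 4)
      (fun x => by ring)]
  ring
end
end
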